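/- Let r,s,p,q ∈ [1,+∞). If E(ℓ_r,p) is Borel reducible to E(ℓ_s,q), or E(L_r,p) is Borel reducible to E(L_s,q), then: (1) p ≤ q; (2) min{r/p, 2/p} ≥ min{s/q, 1, 2/q}; (3) max{r,2} ≤ max{s,q,2}. -/

import Mathlib

open Filter Topology MeasureTheory
open scoped ENNReal NNReal

noncomputable section

/-- `E` is Borel reducible to `F`: there is a Borel (measurable) map `θ` such that
`E x y ↔ F (θ x) (θ y)` for all `x, y`. -/
def BorelReducible {α β : Type*} [MeasurableSpace α] [MeasurableSpace β]
    (E : α → α → Prop) (F : β → β → Prop) : Prop :=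
  ∃ θ : α → β, Measurable θ ∧ ∀ x y, E x y ↔ F (θ x) (θ y)

/-- The sequence space `ℓ_r` of real sequences with summable `r`-th power. -/
abbrev ellSp (r : ℝ) : Type := lp (fun _ : ℕ => ℝ) (ENNReal.ofReal r)

/-- The Lebesgue space `L_r[0,1]` (with respect to Lebesgue measure on `[0,1]`). -/
abbrev LSp (r : ℝ) : Type :=
  MeasureTheory.Lp ℝ (ENNReal.ofReal r) ((volume : Measure ℝ).restrict (Set.Icc 0 1))

/-- The equivalence relation `E(X,p)` on `X^ℕ`:
`x ~ y` iff `Σ_n ‖x n - y n‖^p < ∞`. -/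
def ESum (X : Type*) [NormedAddCommGroup X] (p : ℝ) : (ℕ → X) → (ℕ → X) → Prop :=
  fun x y => Summable fun n => ‖x n - y n‖ ^ p

noncomputable instance {E : ℕ → Type*} [∀ i, NormedAddCommGroup (E i)] (p : ℝ≥0∞)
    [Fact (1 ≤ p)] : MeasurableSpace (lp E p) := borel _
instance {E : ℕ → Type*} [∀ i, NormedAddCommGroup (E i)] (p : ℝ≥0∞)
    [Fact (1 ≤ p)] : BorelSpace (lp E p) := ⟨rfl⟩

noncomputable instance {α : Type*} [MeasurableSpace α] (μ : Measure α) (p : ℝ≥0∞)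
    [Fact (1 ≤ p)] : MeasurableSpace (Lp ℝ p μ) := borel _
instance {α : Type*} [MeasurableSpace α] (μ : Measure α) (p : ℝ≥0∞)
    [Fact (1 ≤ p)] : BorelSpace (Lp ℝ p μ) := ⟨rfl⟩

instance : Fact (1 ≤ ENNReal.ofReal 2) := ⟨ENNReal.one_le_ofReal.2 one_le_two⟩

namespace EBR

/-- Glue. -/
def glue {c : ℕ → ℕ} (l : ℕ) (u z : ∀ n, Fin (c n + 1)) : ∀ n, Fin (c n + 1) :=
  fun n => if n < l then u n else z n

lemma glue_cont {c : ℕ → ℕ} (l : ℕ) (u : ∀ n, Fin (c n + 1)) : Continuous (glue l u) := by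
  refine continuous_pi fun n => ?_
  unfold glue
  split_ifs
  · exact continuous_const
  · exact continuous_apply n

lemma open_cyl {c : ℕ → ℕ} {O : Set (∀ n, Fin (c n + 1))} (hO : IsOpen O) {z} (hz : z ∈ O) :
    ∃ l, ∀ z', (∀ n < l, z' n = z n) → z' ∈ O := by
  obtain ⟨I, u, hu, hsub⟩ := isOpen_pi_iff.1 hO z hz
  refine ⟨I.sup id + 1, fun z' h => hsub ?_⟩
  intro n hn
  rw [h n (Nat.lt_succ_of_le (Finset.le_sup (f := id) hn))]
  exact (hu n hn).2

lemma cyl_open {c : ℕ → ℕ} (l : ℕ) (z : ∀ n, Fin (c n + 1)) :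
    IsOpen {z' : ∀ n, Fin (c n + 1) | ∀ n < l, z' n = z n} := by
  have : {z' : ∀ n, Fin (c n + 1) | ∀ n < l, z' n = z n} =
      ⋂ n ∈ Set.Iio l, {z' : ∀ n, Fin (c n + 1) | z' n = z n} := by
    ext; simp
  rw [this]
  refine (Set.finite_Iio l).isOpen_biInter fun n _ => ?_
  exact (isOpen_discrete ({z n} : Set (Fin (c n + 1)))).preimage
    (continuous_apply (A := fun n => Fin (c n + 1)) n)

lemma glue_open {c : ℕ → ℕ} (l : ℕ) (u : ∀ n, Fin (c n + 1)) : IsOpenMap (glue l u) := by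
  intro O hO
  rw [isOpen_iff_forall_mem_open]
  rintro _ ⟨z, hz, rfl⟩
  obtain ⟨l', hl'⟩ := open_cyl hO hz
  refine ⟨_, ?_, cyl_open (max l l') (glue l u z), ?_⟩
  · intro z' hz'
    refine ⟨glue l z z', hl' _ ?_, ?_⟩
    · intro n hn
      have := hz' n (lt_max_of_lt_right hn)
      simp only [glue] at this ⊢
      split_ifs with h <;> simp_all
    · funext n
      have := hz' n
      simp only [glue] at this ⊢
      split_ifs with h
      · have := this (lt_max_of_lt_left h); simp_all
      · rfl
  · intro n _; rfl

lemma fin_rep {c : ℕ → ℕ} (l : ℕ) : ∃ s : Set (∀ n, Fin (c n + 1)), s.Finite ∧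
    ∀ w : (∀ n, Fin (c n + 1)), ∃ w' ∈ s, ∀ n < l, w' n = w n := by
  refine ⟨Set.range fun w : (∀ n : Fin l, Fin (c n + 1)) =>
    (fun n => if h : n < l then w ⟨n, h⟩ else 0 : ∀ n, Fin (c n + 1)), Set.finite_range _, ?_⟩
  intro w
  exact ⟨_, ⟨fun n => w n, rfl⟩, fun n hn => by simp [hn]⟩

lemma glue_congr {c : ℕ → ℕ} {l : ℕ} {w w' : ∀ n, Fin (c n + 1)} (h : ∀ n < l, w' n = w n) (z) :
    glue l w' z = glue l w z := by
  funext n; simp only [glue]; split_ifs with hn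
  · exact h n hn
  · rfl

/-- Baire-measurable functions are continuous on a residual set. -/
lemma exists_cont {Z Y : Type*} [TopologicalSpace Z] [MeasurableSpace Z] [BorelSpace Z]
    [TopologicalSpace Y] [SecondCountableTopology Y] [MeasurableSpace Y] [BorelSpace Y]
    (g : ℕ → Z → Y) (hg : ∀ i, Measurable (g i)) :
    ∃ R ∈ residual Z, ∀ i, ContinuousOn (g i) R := by
  obtain ⟨b, hbc, -, hb⟩ := TopologicalSpace.exists_countable_basis Y
  have key : ∀ (i : ℕ) (V : Set Y), V ∈ b → ∃ U : Set Z, IsOpen U ∧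
      {z | z ∈ g i ⁻¹' V ↔ z ∈ U} ∈ residual Z := by
    intro i V hV
    obtain ⟨U, hU, h⟩ := ((hg i) (hb.isOpen hV).measurableSet).residualEq_isOpen
    refine ⟨U, hU, ?_⟩
    filter_upwards [h] with z hz
    exact iff_of_eq hz
  choose! U hU hR using key
  refine ⟨⋂ i, ⋂ V ∈ b, {z | z ∈ g i ⁻¹' V ↔ z ∈ U i V}, ?_, ?_⟩
  · rw [countable_iInter_mem]
    intro i
    rw [countable_bInter_mem hbc]
    exact hR i
  · intro i
    refine continuousOn_iff'.2 fun t ht => ?_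
    refine ⟨⋃ V ∈ {V ∈ b | V ⊆ t}, U i V, ?_, ?_⟩
    · exact isOpen_biUnion fun V hV => hU i V hV.1
    · ext z
      constructor
      · rintro ⟨hz, hzR⟩
        refine ⟨?_, hzR⟩
        obtain ⟨V, hV, hzV, hVt⟩ := hb.exists_subset_of_mem_open hz ht
        have := Set.mem_iInter₂.1 (Set.mem_iInter.1 hzR i) V hV
        exact Set.mem_biUnion (show V ∈ {V ∈ b | V ⊆ t} from ⟨hV, hVt⟩) (this.1 hzV)
      · rintro ⟨hz, hzR⟩
        refine ⟨?_, hzR⟩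
        obtain ⟨V, hV, hzV⟩ := Set.mem_iUnion₂.1 hz
        have := Set.mem_iInter₂.1 (Set.mem_iInter.1 hzR i) V hV.1
        exact hV.2 (this.2 hzV)

lemma exists_inv {c : ℕ → ℕ} {R : Set (∀ n, Fin (c n + 1))} (hR : R ∈ residual _) :
    ∃ R' ∈ residual (∀ n, Fin (c n + 1)), R' ⊆ R ∧ ∀ z ∈ R', ∀ z', (∃ l, ∀ n ≥ l, z' n = z n) →
      z' ∈ R' := by
  refine ⟨{z | ∀ z', (∃ l, ∀ n ≥ l, z' n = z n) → z' ∈ R}, ?_, ?_, ?_⟩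
  · choose s hs hs' using fun l => fin_rep (c := c) l
    have : (⋂ l, ⋂ w ∈ s l, glue l w ⁻¹' R) ∈ residual _ := by
      rw [countable_iInter_mem]
      intro l
      rw [countable_bInter_mem (hs l).countable]
      intro w _
      exact tendsto_residual_of_isOpenMap (glue_cont l w) (glue_open l w) hR
    refine mem_of_superset this ?_
    rintro z hz z' ⟨l, hl⟩
    obtain ⟨w, hw, hw'⟩ := hs' l z'
    have h1 : glue l w z ∈ R := Set.mem_iInter₂.1 (Set.mem_iInter.1 hz l) w hw
    have : glue l w z = z' := by
      funext n; simp only [glue]; split_ifs with h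
      · exact hw' n h
      · exact (hl n (not_lt.1 h)).symm
    rwa [← this]
  · intro z hz; exact hz z ⟨0, fun _ _ => rfl⟩
  · rintro z hz z' ⟨l, hl⟩ z'' ⟨l', hl'⟩
    exact hz z'' ⟨max l l', fun n hn => by
      rw [hl' n (le_trans (le_max_right _ _) hn), hl n (le_trans (le_max_left _ _) hn)]⟩


lemma step1 {c : ℕ → ℕ} {O : Set (∀ n, Fin (c n + 1))} (hO : IsOpen O) (hd : Dense O)
    (l l1 : ℕ) (hl : l ≤ l1) (t : ∀ n, Fin (c n + 1)) :
    ∃ l2 ≥ l1, ∃ t' : ∀ n, Fin (c n + 1), (∀ n < l1, t' n = t n) ∧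
      ∀ z : ∀ n, Fin (c n + 1), (∀ n, l ≤ n → n < l2 → z n = t' n) → z ∈ O := by
  obtain ⟨s, hs, hs'⟩ := fin_rep (c := c) l
  have h1 : ∀ w, IsOpen (glue l w ⁻¹' O) := fun w => hO.preimage (glue_cont l w)
  have h2 : ∀ w, Dense (glue l w ⁻¹' O) := fun w => hd.preimage (glue_open l w)
  have h3 : IsOpen (⋂ w ∈ s, glue l w ⁻¹' O) := hs.isOpen_biInter fun w _ => h1 w
  have h4 : Dense (⋂ w ∈ s, glue l w ⁻¹' O) :=
    dense_biInter_of_isOpen (fun w _ => h1 w) hs.countable (fun w _ => h2 w)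
  obtain ⟨t', ht', ht''⟩ := h4.inter_open_nonempty _ (cyl_open l1 t) ⟨t, fun _ _ => rfl⟩
  obtain ⟨l2, hl2⟩ := open_cyl h3 ht''
  refine ⟨max l1 l2, le_max_left _ _, t', ht', ?_⟩
  intro z hz
  obtain ⟨w, hw, hw'⟩ := hs' z
  have h5 : glue l t' z ∈ ⋂ w ∈ s, glue l w ⁻¹' O := by
    refine hl2 _ fun n hn => ?_
    simp only [glue]; split_ifs with h
    · rfl
    · exact hz n (not_lt.1 h) (lt_max_of_lt_right hn)
  have h6 := Set.mem_iInter₂.1 h5 w hw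
  have : glue l w (glue l t' z) = z := by
    funext n; simp only [glue]; split_ifs with h
    · exact hw' n h
    · rfl
  rw [Set.mem_preimage, this] at h6
  exact h6

lemma step3 {c : ℕ → ℕ} {Y : Type*} [NormedAddCommGroup Y] {R : Set (∀ n, Fin (c n + 1))}
    (hRd : Dense R) (hRi : ∀ z ∈ R, ∀ z', (∃ l, ∀ n ≥ l, z' n = z n) → z' ∈ R)
    {θ : (∀ n, Fin (c n + 1)) → ℕ → Y} (hθ : ∀ i, ContinuousOn (fun z => θ z i) R)
    {q : ℝ} (hq : 0 < q) {ε : ℝ} (hε : 0 < ε) (K : ℕ)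
    (l l1 : ℕ) (hl : l ≤ l1) (t : ∀ n, Fin (c n + 1)) :
    ∃ l2 ≥ l1, ∃ t' : ∀ n, Fin (c n + 1), (∀ n < l1, t' n = t n) ∧
      ∀ z ∈ R, ∀ z' ∈ R, (∀ n, l ≤ n → n < l2 → z n = t' n) → (∀ n, n < l2 → z' n = z n) →
        ∑ i ∈ Finset.range K, ‖θ z i - θ z' i‖ ^ q ≤ ε := by
  obtain ⟨s, hs, hs'⟩ := fin_rep (c := c) l
  obtain ⟨t', ht', ht''⟩ := hRd.inter_open_nonempty _ (cyl_open l1 t) ⟨t, fun _ _ => rfl⟩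
  have key : ∀ w, ∃ L, ∀ z ∈ R, ∀ z' ∈ R, (∀ n < L, z n = glue l w t' n) →
      (∀ n < L, z' n = glue l w t' n) → ∑ i ∈ Finset.range K, ‖θ z i - θ z' i‖ ^ q ≤ ε := by
    intro w
    have hw : glue l w t' ∈ R := hRi t' ht'' _ ⟨l, fun n hn => by simp [glue, not_lt.2 hn]⟩
    have hc : Tendsto (fun x : (∀ n, Fin (c n + 1)) × (∀ n, Fin (c n + 1)) =>
        ∑ i ∈ Finset.range K, ‖θ x.1 i - θ x.2 i‖ ^ q)
        (𝓝[R] (glue l w t') ×ˢ 𝓝[R] (glue l w t'))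
        (𝓝 (∑ i ∈ Finset.range K, ‖θ (glue l w t') i - θ (glue l w t') i‖ ^ q)) := by
      refine tendsto_finsetSum _ fun i _ => ?_
      refine Tendsto.rpow_const (Tendsto.norm (Tendsto.sub ?_ ?_)) (Or.inr hq.le)
      · exact (hθ i _ hw).tendsto.comp tendsto_fst
      · exact (hθ i _ hw).tendsto.comp tendsto_snd
    have h0 : (∑ i ∈ Finset.range K, ‖θ (glue l w t') i - θ (glue l w t') i‖ ^ q) < ε := by
      simp [Real.zero_rpow hq.ne', hε]
    have h1 := hc.eventually (gt_mem_nhds h0)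
    obtain ⟨U, hU, V, hV, hUV⟩ := Filter.mem_prod_iff.1 h1
    obtain ⟨U', hU'o, hU', hU's⟩ := mem_nhdsWithin.1 hU
    obtain ⟨V', hV'o, hV', hV's⟩ := mem_nhdsWithin.1 hV
    obtain ⟨L1, hL1⟩ := open_cyl hU'o hU'
    obtain ⟨L2, hL2⟩ := open_cyl hV'o hV'
    refine ⟨max L1 L2, fun z hz z' hz' h h' => le_of_lt ?_⟩
    have := @hUV (z, z') ⟨hU's ⟨hL1 z fun n hn => h n (lt_max_of_lt_left hn), hz⟩,
      hV's ⟨hL2 z' fun n hn => h' n (lt_max_of_lt_right hn), hz'⟩⟩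
    exact this
  choose L hL using key
  obtain ⟨B, hB⟩ := (hs.image L).bddAbove
  refine ⟨max l1 B, le_max_left _ _, t', ht', ?_⟩
  intro z hz z' hz' h1 h2
  obtain ⟨w, hw, hw'⟩ := hs' z
  have hLB : L w ≤ B := hB ⟨w, hw, rfl⟩
  have h3 : ∀ n < L w, z n = glue l w t' n := by
    intro n hn
    simp only [glue]; split_ifs with h
    · exact (hw' n h).symm
    · exact h1 n (not_lt.1 h) (lt_max_of_lt_right (lt_of_lt_of_le hn hLB))
  refine hL w z hz z' hz' h3 fun n hn => ?_
  rw [h2 n (lt_max_of_lt_right (lt_of_lt_of_le hn hLB)), h3 n hn]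

lemma step2 {c : ℕ → ℕ} {Y : Type*} [NormedAddCommGroup Y] {R : Set (∀ n, Fin (c n + 1))}
    {O : ℕ → Set (∀ n, Fin (c n + 1))} (hO : ∀ j, IsOpen (O j)) (hOd : ∀ j, Dense (O j))
    (hOR : ⋂ j, O j ⊆ R)
    (hRi : ∀ z ∈ R, ∀ z', (∃ l, ∀ n ≥ l, z' n = z n) → z' ∈ R)
    {θ : (∀ n, Fin (c n + 1)) → ℕ → Y} (hθ : ∀ i, ContinuousOn (fun z => θ z i) R)
    {q : ℝ} (hq : 0 < q)
    (hs : ∀ z z', (∃ l, ∀ n ≥ l, z' n = z n) → Summable fun i => ‖θ z i - θ z' i‖ ^ q)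
    {ε : ℝ} (hε : 0 < ε)
    (l l1 : ℕ) (hl : l ≤ l1) (t : ∀ n, Fin (c n + 1)) :
    ∃ l2 ≥ l1, ∃ t' : ∀ n, Fin (c n + 1), (∀ n < l1, t' n = t n) ∧ ∃ K,
      ∀ z ∈ R, ∀ z', (∀ n, l ≤ n → n < l2 → z n = t' n) → (∀ n, l ≤ n → z' n = z n) →
        ∀ M, ∑ i ∈ Finset.Ico K M, ‖θ z i - θ z' i‖ ^ q ≤ ε := by
  obtain ⟨s, hsf, hs'⟩ := fin_rep (c := c) l
  have hgR : ∀ z ∈ R, ∀ w, glue l w z ∈ R := fun z hz w =>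
    hRi z hz _ ⟨l, fun n hn => by simp [glue, not_lt.2 hn]⟩
  set B : ℕ → Set (∀ n, Fin (c n + 1)) := fun K => {z | z ∈ R ∧ ∀ w w', ∀ M,
    ∑ i ∈ Finset.Ico K M, ‖θ (glue l w z) i - θ (glue l w' z) i‖ ^ q ≤ ε} with hB
  have hBcl : ∀ K, ∀ z ∈ R, z ∈ closure (B K) → z ∈ B K := by
    intro K z hz hcl
    refine ⟨hz, fun w w' M => ?_⟩
    have hne : (𝓝[B K] z).NeBot := mem_closure_iff_nhdsWithin_neBot.1 hcl
    have hc : Tendsto (fun z => ∑ i ∈ Finset.Ico K M, ‖θ (glue l w z) i - θ (glue l w' z) i‖ ^ q)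
      (𝓝[B K] z) (𝓝 (∑ i ∈ Finset.Ico K M, ‖θ (glue l w z) i - θ (glue l w' z) i‖ ^ q)) := by
      refine tendsto_finsetSum _ fun i _ => ?_
      refine Tendsto.rpow_const (Tendsto.norm (Tendsto.sub ?_ ?_)) (Or.inr hq.le)
      · have : ContinuousOn (fun z => θ (glue l w z) i) R :=
          (hθ i).comp (glue_cont l w).continuousOn fun z hz => hgR z hz w
        exact ((this z hz).mono (fun z hz => hz.1)).tendsto
      · have : ContinuousOn (fun z => θ (glue l w' z) i) R :=
          (hθ i).comp (glue_cont l w').continuousOn fun z hz => hgR z hz w'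
        exact ((this z hz).mono (fun z hz => hz.1)).tendsto
    exact le_of_tendsto hc (eventually_nhdsWithin_of_forall fun z hz => hz.2 w w' M)
  have hcov : ∀ z ∈ R, ∃ K, z ∈ B K := by
    intro z hz
    have h1 : ∀ x : (∀ n, Fin (c n + 1)) × (∀ n, Fin (c n + 1)), ∃ K, ∀ M,
        ∑ i ∈ Finset.Ico K M, ‖θ (glue l x.1 z) i - θ (glue l x.2 z) i‖ ^ q ≤ ε := by
      intro x
      have := hs (glue l x.1 z) (glue l x.2 z) ⟨l, fun n hn => by simp [glue, not_lt.2 hn]⟩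
      obtain ⟨F, hF⟩ := this.vanishing (Iio_mem_nhds hε)
      refine ⟨F.sup id + 1, fun M => le_of_lt (hF _ ?_)⟩
      rw [Finset.disjoint_left]
      intro a ha haF
      have := Finset.le_sup (f := id) haF
      simp at ha this
      omega
    choose κ hκ using h1
    obtain ⟨K, hK⟩ := ((hsf.prod hsf).image κ).bddAbove
    refine ⟨K, hz, fun w w' M => ?_⟩
    obtain ⟨v, hv, hv'⟩ := hs' w
    obtain ⟨v2, hv2, hv2'⟩ := hs' w'
    rw [← glue_congr hv', ← glue_congr hv2']
    refine le_trans ?_ (hκ (v, v2) M)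
    refine Finset.sum_le_sum_of_subset_of_nonneg ?_ fun i _ _ => by positivity
    exact Finset.Ico_subset_Ico_left (hK ⟨(v, v2), ⟨hv, hv2⟩, rfl⟩)
  have hden : Dense (⋃ x : ℕ ⊕ ℕ, interior (Sum.elim (fun K => closure (B K)) (fun j => (O j)ᶜ) x)) := by
    refine dense_iUnion_interior_of_closed ?_ ?_
    · rintro (K | j)
      · exact isClosed_closure
      · exact (hO j).isClosed_compl
    · rw [Set.eq_univ_iff_forall]
      intro z
      by_cases hz : z ∈ ⋂ j, O j
      · obtain ⟨K, hK⟩ := hcov z (hOR hz)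
        exact Set.mem_iUnion.2 ⟨Sum.inl K, subset_closure hK⟩
      · simp only [Set.mem_iInter, not_forall] at hz
        obtain ⟨j, hj⟩ := hz
        exact Set.mem_iUnion.2 ⟨Sum.inr j, hj⟩
  obtain ⟨t', ht', ht''⟩ := hden.inter_open_nonempty _ (cyl_open l1 t) ⟨t, fun _ _ => rfl⟩
  obtain ⟨x, hx⟩ := Set.mem_iUnion.1 ht''
  rcases x with K | j
  · simp only [Sum.elim_inl] at hx
    obtain ⟨l2, hl2⟩ := open_cyl isOpen_interior hx
    refine ⟨max l1 l2, le_max_left _ _, t', ht', K, ?_⟩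
    intro z hz z' h1 h2 M
    have h5 : glue l t' z ∈ interior (closure (B K)) := by
      refine hl2 _ fun n hn => ?_
      simp only [glue]; split_ifs with h
      · rfl
      · exact h1 n (not_lt.1 h) (lt_max_of_lt_right hn)
    have h6 := hBcl K _ (hgR z hz t') (interior_subset h5)
    have h7 := h6.2 z z' M
    have e1 : glue l z (glue l t' z) = z := by
      funext n; simp only [glue]; split_ifs <;> rfl
    have e2 : glue l z' (glue l t' z) = z' := by
      funext n; simp only [glue]; split_ifs with h
      · rfl
      · exact (h2 n (not_lt.1 h)).symm
    rwa [e1, e2] at h7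
  · exfalso
    simp only [Sum.elim_inr, interior_compl, (hOd j).closure_eq] at hx
    simp at hx

end EBR


namespace EBR

lemma rpow_add_le2 {a b q : ℝ} (ha : 0 ≤ a) (hb : 0 ≤ b) (hq : 0 < q) :
    (a + b) ^ q ≤ 2 ^ q * (a ^ q + b ^ q) := by
  have h1 : (a + b) ^ q ≤ (2 * max a b) ^ q := by
    apply Real.rpow_le_rpow (by positivity) _ hq.le
    have := le_max_left a b; have := le_max_right a b; linarith
  rw [Real.mul_rpow (by norm_num) (by positivity)] at h1
  refine h1.trans ?_
  gcongr
  rcases max_cases a b with h | h <;> rw [h.1]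
  · have : 0 ≤ b ^ q := by positivity
    linarith
  · have : 0 ≤ a ^ q := by positivity
    linarith

lemma norm_rpow_tri {Y : Type*} [NormedAddCommGroup Y] {q : ℝ} (hq : 0 < q) (a b c : Y) :
    ‖a - c‖ ^ q ≤ 2 ^ q * (‖a - b‖ ^ q + ‖b - c‖ ^ q) := by
  refine le_trans ?_ (rpow_add_le2 (norm_nonneg _) (norm_nonneg _) hq)
  exact Real.rpow_le_rpow (norm_nonneg _) (norm_sub_le_norm_sub_add_norm_sub a b c) hq.le

lemma sum_rpow_tri {Y : Type*} [NormedAddCommGroup Y] {q : ℝ} (hq : 0 < q) (s : Finset ℕ)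
    (a b c : ℕ → Y) :
    ∑ i ∈ s, ‖a i - c i‖ ^ q ≤ 2 ^ q * (∑ i ∈ s, ‖a i - b i‖ ^ q + ∑ i ∈ s, ‖b i - c i‖ ^ q) := by
  rw [← Finset.sum_add_distrib, Finset.mul_sum]
  exact Finset.sum_le_sum fun i _ => norm_rpow_tri hq _ _ _

lemma summable_blocks {K : ℕ → ℕ} (hK0 : K 0 = 0) (hK : StrictMono K) {g : ℕ → ℝ}
    (hg : ∀ i, 0 ≤ g i) :
    Summable g ↔ Summable fun j => ∑ i ∈ Finset.Ico (K j) (K (j + 1)), g i := by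
  have hp : ∀ J, ∑ j ∈ Finset.range J, ∑ i ∈ Finset.Ico (K j) (K (j + 1)), g i =
      ∑ i ∈ Finset.range (K J), g i := by
    intro J
    induction J with
    | zero => simp [hK0]
    | succ J ih =>
      rw [Finset.sum_range_succ, ih, Finset.sum_range_add_sum_Ico _ (hK (Nat.lt_succ_self J)).le]
  constructor
  · intro h
    refine summable_of_sum_range_le (c := ∑' i, g i) (fun j => Finset.sum_nonneg fun i _ => hg i) ?_
    intro J
    rw [hp]
    exact h.sum_le_tsum _ fun i _ => hg i
  · intro h
    refine summable_of_sum_range_le (c := ∑' j, ∑ i ∈ Finset.Ico (K j) (K (j + 1)), g i) hg ?_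
    intro J
    refine le_trans ?_ (h.sum_le_tsum (Finset.range J)
      fun i _ => Finset.sum_nonneg fun i _ => hg i)
    rw [hp]
    refine Finset.sum_le_sum_of_subset_of_nonneg ?_ fun i _ _ => hg i
    exact Finset.range_subset_range.2 hK.le_apply

lemma step {c : ℕ → ℕ} {Y : Type*} [NormedAddCommGroup Y] {R : Set (∀ n, Fin (c n + 1))}
    {O : ℕ → Set (∀ n, Fin (c n + 1))} (hO : ∀ j, IsOpen (O j)) (hOd : ∀ j, Dense (O j))
    (hOR : ⋂ j, O j ⊆ R) (hRd : Dense R)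
    (hRi : ∀ z ∈ R, ∀ z', (∃ l, ∀ n ≥ l, z' n = z n) → z' ∈ R)
    {θ : (∀ n, Fin (c n + 1)) → ℕ → Y} (hθ : ∀ i, ContinuousOn (fun z => θ z i) R)
    {q : ℝ} (hq : 0 < q)
    (hs : ∀ z z', (∃ l, ∀ n ≥ l, z' n = z n) → Summable fun i => ‖θ z i - θ z' i‖ ^ q)
    (l K0 j : ℕ) :
    ∃ (l2 : ℕ) (t : ∀ n, Fin (c n + 1)) (K : ℕ), l ≤ l2 ∧ K0 < K ∧
      (∀ z : (∀ n, Fin (c n + 1)), (∀ n, l ≤ n → n < l2 → z n = t n) → z ∈ O j) ∧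
      (∀ z ∈ R, ∀ z', (∀ n, l ≤ n → n < l2 → z n = t n) → (∀ n, l ≤ n → z' n = z n) →
        ∀ M, ∑ i ∈ Finset.Ico K M, ‖θ z i - θ z' i‖ ^ q ≤ (1 / 2) ^ j) ∧
      (∀ z ∈ R, ∀ z' ∈ R, (∀ n, l ≤ n → n < l2 → z n = t n) → (∀ n, n < l2 → z' n = z n) →
        ∑ i ∈ Finset.range K, ‖θ z i - θ z' i‖ ^ q ≤ (1 / 2) ^ j) := by
  have hε : (0 : ℝ) < (1 / 2) ^ j := by positivity
  obtain ⟨l1, hl1, t1, -, h1⟩ := step1 (hO j) (hOd j) l l le_rfl (fun _ => 0)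
  obtain ⟨l2, hl2, t2, ht2, K, h2⟩ := step2 hO hOd hOR hRi hθ hq hs hε l l1 hl1 t1
  obtain ⟨l3, hl3, t3, ht3, h3⟩ := step3 hRd hRi hθ hq hε (max K (K0 + 1)) l l2 (hl1.trans hl2) t2
  refine ⟨l3, t3, max K (K0 + 1), (hl1.trans hl2).trans hl3, lt_max_of_lt_right (Nat.lt_succ_self _),
    ?_, ?_, h3⟩
  · intro z hz
    refine h1 z fun n hn hn' => ?_
    rw [hz n hn (hn'.trans_le (hl2.trans hl3)), ht3 n (hn'.trans_le hl2), ht2 n hn']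
  · intro z hz z' hz1 hz2 M
    refine le_trans ?_ (h2 z hz z' (fun n hn hn' => ?_) hz2 M)
    · refine Finset.sum_le_sum_of_subset_of_nonneg ?_ fun i _ _ => by positivity
      exact Finset.Ico_subset_Ico_left (le_max_left _ _)
    · rw [hz1 n hn (hn'.trans_le hl3), ht3 n hn']

lemma fusion {c : ℕ → ℕ} {Y : Type*} [NormedAddCommGroup Y] [SecondCountableTopology Y]
    [MeasurableSpace Y] [BorelSpace Y]
    {θ : (∀ n, Fin (c n + 1)) → ℕ → Y} (hθ : Measurable θ) {q : ℝ} (hq : 0 < q)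
    (hs : ∀ z z', (∃ l, ∀ n ≥ l, z' n = z n) → Summable fun i => ‖θ z i - θ z' i‖ ^ q)
    (τ κ : ℕ → ℕ) (hτ : ∀ k l, ∃ n ≥ l, τ n = k) :
    ∃ (nn : ℕ → ℕ) (K : ℕ → ℕ) (f : ∀ j, Fin (c (nn j) + 1) → ℕ → Y) (T : ∀ n, Fin (c n + 1)),
      StrictMono nn ∧ (∀ j, τ (nn j) = κ j) ∧
      ∀ x y : ∀ n, Fin (c n + 1),
        (Summable fun i => ‖θ (fun n => open Classical in if n ∈ Set.range nn then x n else T n) i -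
          θ (fun n => open Classical in if n ∈ Set.range nn then y n else T n) i‖ ^ q) ↔
        Summable fun j => ∑ i ∈ Finset.Ico (K j) (K (j + 1)),
          ‖f j (x (nn j)) i - f j (y (nn j)) i‖ ^ q := by
  classical
  obtain ⟨R0, hR0, hc0⟩ := exists_cont (fun i z => θ z i) (fun i => (measurable_pi_apply i).comp hθ)
  obtain ⟨R, hR, hRR0, hRi⟩ := exists_inv hR0
  have hc : ∀ i, ContinuousOn (fun z => θ z i) R := fun i => (hc0 i).mono hRR0
  have hRd : Dense R := dense_of_mem_residual hR
  obtain ⟨O, hO, hOd, hOR⟩ : ∃ O : ℕ → Set (∀ n, Fin (c n + 1)), (∀ j, IsOpen (O j)) ∧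
      (∀ j, Dense (O j)) ∧ ⋂ j, O j ⊆ R := by
    obtain ⟨S, hS1, hS2, hS3, hS4⟩ := mem_residual_iff.1 hR
    rcases S.eq_empty_or_nonempty with rfl | hne
    · refine ⟨fun _ => Set.univ, by simp, by simp, ?_⟩
      simpa using hS4
    · obtain ⟨O, rfl⟩ := hS3.exists_eq_range hne
      exact ⟨O, fun j => hS1 _ ⟨j, rfl⟩, fun j => hS2 _ ⟨j, rfl⟩, by rwa [← Set.sInter_range]⟩
  choose L T K hL hK h1 h2 h3 using step hO hOd hOR hRd hRi hc hq hs
  choose N hN hN' using hτ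
  let st : ℕ → ℕ × ℕ := fun j => Nat.rec (0, 0)
    (fun j s => (L (N (κ j) s.1 + 1) s.2 j, K (N (κ j) s.1 + 1) s.2 j)) j
  let l : ℕ → ℕ := fun j => (st j).1
  let k : ℕ → ℕ := fun j => (st j).2
  let nn : ℕ → ℕ := fun j => N (κ j) (l j)
  let t : ∀ j, ∀ n, Fin (c n + 1) := fun j => T (nn j + 1) (k j) j
  have hl0 : l 0 = 0 := rfl
  have hk0 : k 0 = 0 := rfl
  have hls : ∀ j, l (j + 1) = L (nn j + 1) (k j) j := fun j => rfl
  have hks : ∀ j, k (j + 1) = K (nn j + 1) (k j) j := fun j => rfl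
  have hln : ∀ j, l j ≤ nn j := fun j => hN _ _
  have hnl : ∀ j, nn j + 1 ≤ l (j + 1) := fun j => by rw [hls]; exact hL _ _ _
  have hkm : StrictMono k := strictMono_nat_of_lt_succ fun j => by rw [hks]; exact hK _ _ _
  have hnm : StrictMono nn := strictMono_nat_of_lt_succ fun j => by
    have := hnl j; have := hln (j + 1); omega
  have hlm : Monotone l := monotone_nat_of_le_succ fun j => by
    have := hnl j; have := hln j; omega
  have huniq : ∀ n i j, nn i < n → n < l (i + 1) → nn j < n → n < l (j + 1) → i = j := by
    intro n i j a b c' d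
    rcases lt_trichotomy i j with h | h | h
    · have := hlm (show i + 1 ≤ j from h); have := hln j; omega
    · exact h
    · have := hlm (show j + 1 ≤ i from h); have := hln i; omega
  have hnr : ∀ j n, nn j < n → n < l (j + 1) → n ∉ Set.range nn := by
    rintro j n a b ⟨i, rfl⟩
    have hji := hnm.lt_iff_lt.1 a
    have := hlm (show j + 1 ≤ i from hji); have := hln i; omega
  let Tm : ∀ n, Fin (c n + 1) := fun n =>
    if h : ∃ j, nn j < n ∧ n < l (j + 1) then t h.choose n else 0
  have hTm : ∀ j n, nn j < n → n < l (j + 1) → Tm n = t j n := by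
    intro j n a b
    have h : ∃ j, nn j < n ∧ n < l (j + 1) := ⟨j, a, b⟩
    have : h.choose = j := huniq n _ _ h.choose_spec.1 h.choose_spec.2 a b
    simp only [Tm, h, dif_pos]
    rw [this]
  let φ : (∀ n, Fin (c n + 1)) → (∀ n, Fin (c n + 1)) := fun x n =>
    if n ∈ Set.range nn then x n else Tm n
  have hφt : ∀ x j n, nn j + 1 ≤ n → n < l (j + 1) → φ x n = t j n := by
    intro x j n a b
    simp only [φ, hnr j n a b, if_false, hTm j n a b]
  have hφR : ∀ x, φ x ∈ R := fun x => hOR <| Set.mem_iInter.2 fun j =>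
    h1 (nn j + 1) (k j) j _ fun n a b => hφt x j n a b
  let f : ∀ j, Fin (c (nn j) + 1) → ℕ → Y := fun j a =>
    θ (φ (Function.update (fun _ => 0) (nn j) a))
  have key : ∀ x j, ∑ i ∈ Finset.Ico (k j) (k (j + 1)), ‖θ (φ x) i - f j (x (nn j)) i‖ ^ q ≤
      2 ^ q * ((1 / 2) ^ j + 2 * (1 / 2) ^ j) := by
    intro x j
    let x' : ∀ n, Fin (c n + 1) := fun n => if n < l (j + 1) then x n else 0
    refine (sum_rpow_tri hq _ _ (θ (φ x')) _).trans ?_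
    gcongr
    · refine le_trans ?_ (h3 (nn j + 1) (k j) j (φ x) (hφR x) (φ x') (hφR x') ?_ ?_)
      · refine Finset.sum_le_sum_of_subset_of_nonneg ?_ fun i _ _ => by positivity
        intro i hi
        simp at hi ⊢
        exact hi.2
      · exact hφt x j
      · intro n hn
        have hn' : n < l (j + 1) := hn
        simp only [φ, x', hn', if_true]
    · have hag : ∀ n, l j ≤ n → φ (Function.update (fun _ => 0) (nn j) (x (nn j))) n = φ x' n := by
        intro n hn
        simp only [φ]
        split_ifs with hr
        · obtain ⟨i, rfl⟩ := hr
          by_cases hij : i = j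
          · subst hij
            have : nn i < l (i + 1) := hnl i
            simp [x', this]
          · have hlt : j < i := by
              by_contra hcon
              have h : i + 1 ≤ j := by omega
              have := hlm h; have := hnl i; omega
            have h5 : ¬ nn i < l (j + 1) := by
              have := hlm (show j + 1 ≤ i from hlt); have := hln i; omega
            have h6 : nn i ≠ nn j := fun h => hij (hnm.injective h)
            simp [x', h5, Function.update_of_ne h6]
        · rfl
      rcases j with _ | j
      · have : φ (Function.update (fun _ => 0) (nn 0) (x (nn 0))) = φ x' := by
          funext n; exact hag n (by simp [hl0])
        simp only [f, this, sub_self, norm_zero, Real.zero_rpow hq.ne']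
        simp
      · have := h2 (nn j + 1) (k j) j (φ x') (hφR x')
          (φ (Function.update (fun _ => 0) (nn (j + 1)) (x (nn (j + 1))))) (hφt x' j) ?_ (k (j + 1 + 1))
        · refine this.trans (le_of_eq ?_)
          rw [pow_succ]; ring
        · intro n hn
          by_cases hnl' : l (j + 1) ≤ n
          · exact hag n hnl'
          · have := hnr j n hn (not_le.1 hnl')
            simp only [φ, this, if_false]
  have hsum : Summable fun j : ℕ => (2 : ℝ) ^ q * ((1 / 2) ^ j + 2 * (1 / 2) ^ j) := by
    have := summable_geometric_two
    exact ((this.add (this.mul_left 2)).mul_left _)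
  refine ⟨nn, k, f, Tm, hnm, fun j => hN' _ _, fun x y => ?_⟩
  rw [summable_blocks hk0 hkm (fun i => by positivity)]
  have keyx : ∀ x, Summable fun j => ∑ i ∈ Finset.Ico (k j) (k (j + 1)),
      ‖θ (φ x) i - f j (x (nn j)) i‖ ^ q := fun x =>
    Summable.of_nonneg_of_le (fun j => by positivity) (key x) hsum
  have keyx' : ∀ x, Summable fun j => ∑ i ∈ Finset.Ico (k j) (k (j + 1)),
      ‖f j (x (nn j)) i - θ (φ x) i‖ ^ q := fun x => by
    exact (keyx x).congr fun j => Finset.sum_congr rfl fun i _ => by rw [norm_sub_rev]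
  constructor
  · intro h
    refine Summable.of_nonneg_of_le (fun j => by positivity) (fun j => ?_)
      ((((keyx' x).add ((h.add (keyx y)).mul_left (2 ^ q)))).mul_left (2 ^ q))
    refine (sum_rpow_tri hq _ _ (θ (φ x)) _).trans ?_
    gcongr
    exact sum_rpow_tri hq _ _ (θ (φ y)) _
  · intro h
    refine Summable.of_nonneg_of_le (fun j => by positivity) (fun j => ?_)
      ((((keyx x).add ((h.add (keyx' y)).mul_left (2 ^ q)))).mul_left (2 ^ q))
    refine (sum_rpow_tri hq _ _ (f j (x (nn j))) _).trans ?_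
    gcongr
    exact sum_rpow_tri hq _ _ (f j (y (nn j))) _

end EBR


namespace EBR

lemma pick_block {J : Set ℕ} (hJ : J.Infinite) {d : ℕ → ℝ} {δ T : ℝ} (hδ : 0 < δ) (hT : 0 < T)
    (h1 : ∀ j ∈ J, δ ≤ d j) (h2 : ∀ j ∈ J, d j ≤ T) :
    ∃ B : Finset ℕ, (∀ j ∈ B, j ∈ J) ∧ T ≤ ∑ j ∈ B, d j ∧ ∑ j ∈ B, d j ≤ 2 * T := by
  classical
  have hex : ∃ n, ∃ B : Finset ℕ, (∀ j ∈ B, j ∈ J) ∧ T ≤ ∑ j ∈ B, d j ∧ B.card = n := by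
    obtain ⟨m, hm⟩ := exists_nat_gt (T / δ)
    obtain ⟨B, hB, hc⟩ := hJ.exists_subset_card_eq m
    refine ⟨m, B, fun j hj => hB hj, ?_, hc⟩
    have : (B.card : ℝ) * δ ≤ ∑ j ∈ B, d j := by
      rw [← nsmul_eq_mul]
      exact Finset.card_nsmul_le_sum _ _ _ fun j hj => h1 j (hB hj)
    rw [hc] at this
    rw [div_lt_iff₀ hδ] at hm
    linarith
  obtain ⟨B, hB, hs, hc⟩ := Nat.find_spec hex
  refine ⟨B, hB, hs, ?_⟩
  rcases B.eq_empty_or_nonempty with rfl | ⟨j, hj⟩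
  · simp at hs ⊢; linarith
  · have hlt : ∑ i ∈ B.erase j, d i < T := by
      by_contra hcon
      push Not at hcon
      have h3 := Nat.find_min' hex ⟨B.erase j, fun i hi => hB i (Finset.mem_of_mem_erase hi), hcon, rfl⟩
      have := Finset.card_erase_lt_of_mem hj
      omega
    rw [← Finset.add_sum_erase _ _ hj]
    have := h2 j (hB j hj)
    linarith

lemma comb1 {κ c : ℕ → ℕ} (D U W : ∀ j, Fin (c j + 1) → Fin (c j + 1) → ℝ)
    (hU : ∀ j a b, 0 ≤ U j a b) (hW : ∀ j a b, 0 ≤ W j a b) (hU0 : ∀ j a, U j a a = 0)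
    (T α β : ℕ → ℝ) (hT : ∀ i, 0 < T i)
    (hα : ∀ i, 0 ≤ α i ∧ α i * T i ≤ (1 / 2) ^ i) (hβ : ∀ i, 0 ≤ β i ∧ 1 ≤ β i * T i)
    (hδ : ∀ k, ∃ δ > 0, ∀ j, κ j = k → ∀ a b, 0 < D j a b → δ ≤ D j a b)
    (hDT : ∀ i j, i ≤ κ j → ∀ a b, D j a b ≤ T i)
    (P : ∀ i j : ℕ, Fin (c j + 1) → Fin (c j + 1) → Prop)
    (hP : ∀ i j a b, P i j a b → 0 < D j a b ∧ U j a b ≤ α i * D j a b ∧ β i * D j a b ≤ W j a b)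
    (H : ∀ x y : ∀ j, Fin (c j + 1), (Summable fun j => U j (x j) (y j)) →
      Summable fun j => W j (x j) (y j)) :
    ∃ i, ∀ k ≥ i, {j | κ j = k ∧ ∃ a b, P i j a b}.Finite := by
  classical
  by_contra hcon
  push Not at hcon
  choose k hk hinf using hcon
  let m : ℕ → ℕ := fun n => Nat.rec 0 (fun _ m => k m + 1) n
  have hms : ∀ n, m (n + 1) = k (m n) + 1 := fun n => rfl
  have hmm : StrictMono m := strictMono_nat_of_lt_succ fun n => by
    rw [hms]; have := hk (m n); omega
  have hkm : StrictMono fun n => k (m n) := strictMono_nat_of_lt_succ fun n => by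
    have := hk (m (n + 1)); have := hms n; omega
  have hab : ∀ n j, ∃ a b, (κ j = k (m n) ∧ ∃ a b, P (m n) j a b) → P (m n) j a b := by
    intro n j
    by_cases h : κ j = k (m n) ∧ ∃ a b, P (m n) j a b
    · obtain ⟨h1, a, b, h2⟩ := h
      exact ⟨a, b, fun _ => h2⟩
    · exact ⟨0, 0, fun h' => absurd h' h⟩
  choose a b hab using hab
  have hB : ∀ n, ∃ B : Finset ℕ, (∀ j ∈ B, κ j = k (m n) ∧ P (m n) j (a n j) (b n j)) ∧
      T (m n) ≤ ∑ j ∈ B, D j (a n j) (b n j) ∧ ∑ j ∈ B, D j (a n j) (b n j) ≤ 2 * T (m n) := by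
    intro n
    obtain ⟨δ, h0, h1⟩ := hδ (k (m n))
    obtain ⟨B, h2, h3⟩ := pick_block (hinf (m n)) (d := fun j => D j (a n j) (b n j)) h0 (hT (m n))
      (fun j hj => h1 j hj.1 _ _ (hP _ _ _ _ (hab n j hj)).1)
      (fun j hj => hDT _ _ (by rw [hj.1]; exact hk _) _ _)
    exact ⟨B, fun j hj => ⟨(h2 j hj).1, hab n j (h2 j hj)⟩, h3⟩
  choose B hB1 hB2 hB3 using hB
  have huniq : ∀ n n' j, j ∈ B n → j ∈ B n' → n = n' := fun n n' j h h' =>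
    hkm.injective ((hB1 n j h).1.symm.trans (hB1 n' j h').1)
  have hdisj : ∀ s : Set ℕ, s.PairwiseDisjoint B := fun s n _ n' _ hne =>
    Finset.disjoint_left.2 fun j h h' => hne (huniq n n' j h h')
  let x : ∀ j, Fin (c j + 1) := fun j => if h : ∃ n, j ∈ B n then a h.choose j else 0
  let y : ∀ j, Fin (c j + 1) := fun j => if h : ∃ n, j ∈ B n then b h.choose j else 0
  have hx : ∀ n, ∀ j ∈ B n, x j = a n j := by
    intro n j hj
    have h : ∃ n, j ∈ B n := ⟨n, hj⟩
    have : h.choose = n := huniq _ _ _ h.choose_spec hj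
    simp only [x, h, dif_pos]; rw [this]
  have hy : ∀ n, ∀ j ∈ B n, y j = b n j := by
    intro n j hj
    have h : ∃ n, j ∈ B n := ⟨n, hj⟩
    have : h.choose = n := huniq _ _ _ h.choose_spec hj
    simp only [y, h, dif_pos]; rw [this]
  have hUs : ∀ n, ∑ j ∈ B n, U j (x j) (y j) ≤ 2 * (1 / 2) ^ n := by
    intro n
    calc ∑ j ∈ B n, U j (x j) (y j) ≤ ∑ j ∈ B n, α (m n) * D j (a n j) (b n j) := by
          refine Finset.sum_le_sum fun j hj => ?_
          rw [hx n j hj, hy n j hj]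
          exact (hP _ _ _ _ (hB1 n j hj).2).2.1
      _ = α (m n) * ∑ j ∈ B n, D j (a n j) (b n j) := by rw [Finset.mul_sum]
      _ ≤ α (m n) * (2 * T (m n)) := mul_le_mul_of_nonneg_left (hB3 n) (hα _).1
      _ = 2 * (α (m n) * T (m n)) := by ring
      _ ≤ 2 * (1 / 2) ^ (m n) := by gcongr; exact (hα _).2
      _ ≤ 2 * (1 / 2) ^ n := by
          gcongr ?_ * ?_
          exact pow_le_pow_of_le_one (by norm_num) (by norm_num) (hmm.le_apply)
  have hWs : ∀ n, 1 ≤ ∑ j ∈ B n, W j (x j) (y j) := by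
    intro n
    calc 1 ≤ β (m n) * T (m n) := (hβ _).2
      _ ≤ β (m n) * ∑ j ∈ B n, D j (a n j) (b n j) := mul_le_mul_of_nonneg_left (hB2 n) (hβ _).1
      _ = ∑ j ∈ B n, β (m n) * D j (a n j) (b n j) := by rw [Finset.mul_sum]
      _ ≤ _ := by
          refine Finset.sum_le_sum fun j hj => ?_
          rw [hx n j hj, hy n j hj]
          exact (hP _ _ _ _ (hB1 n j hj).2).2.2
  have hsU : Summable fun j => U j (x j) (y j) := by
    have hg : Summable fun n : ℕ => 2 * (1 / 2 : ℝ) ^ n := summable_geometric_two.mul_left 2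
    refine summable_of_sum_le (c := ∑' n : ℕ, 2 * (1 / 2 : ℝ) ^ n) (fun j => hU _ _ _) fun s => ?_
    let s' := s.filter fun j => ∃ n, j ∈ B n
    have e1 : ∑ j ∈ s, U j (x j) (y j) = ∑ j ∈ s', U j (x j) (y j) := by
      refine (Finset.sum_filter_of_ne fun j _ hne => ?_).symm
      by_contra h
      apply hne
      simp only [x, y, h, dif_neg, not_false_eq_true]
      exact hU0 _ _
    let nf : ℕ → ℕ := fun j => if h : ∃ n, j ∈ B n then h.choose else 0
    have e2 : s' ⊆ (s'.image nf).biUnion B := by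
      intro j hj
      have h : ∃ n, j ∈ B n := (Finset.mem_filter.1 hj).2
      refine Finset.mem_biUnion.2 ⟨nf j, Finset.mem_image_of_mem _ hj, ?_⟩
      simp only [nf, h, dif_pos]
      exact h.choose_spec
    rw [e1]
    refine (Finset.sum_le_sum_of_subset_of_nonneg e2 fun j _ _ => hU _ _ _).trans ?_
    rw [Finset.sum_biUnion (hdisj _)]
    refine (Finset.sum_le_sum fun n _ => hUs n).trans ?_
    exact hg.sum_le_tsum _ fun n _ => by positivity
  have hsW := H x y hsU
  obtain ⟨M, hM⟩ := exists_nat_gt (∑' j, W j (x j) (y j))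
  have h4 := hsW.sum_le_tsum ((Finset.range M).biUnion B) fun j _ => hW _ _ _
  rw [Finset.sum_biUnion (hdisj _)] at h4
  have h5 : (M : ℝ) ≤ ∑ n ∈ Finset.range M, ∑ j ∈ B n, W j (x j) (y j) := by
    have := Finset.card_nsmul_le_sum (Finset.range M) (fun n => ∑ j ∈ B n, W j (x j) (y j)) 1 fun n _ => hWs n
    simpa using this
  linarith

lemma exists_delta {ι : Type*} [Finite ι] (g : ι → ℝ) : ∃ δ > 0, ∀ i, 0 < g i → δ ≤ g i := by
  classical
  cases nonempty_fintype ι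
  by_cases h : (Finset.univ.filter fun i => 0 < g i).Nonempty
  · obtain ⟨i, hi, hm⟩ := Finset.exists_min_image _ g h
    exact ⟨g i, (Finset.mem_filter.1 hi).2, fun j hj => hm j (by simpa using hj)⟩
  · refine ⟨1, one_pos, fun i hi => ?_⟩
    exact absurd ⟨i, by simpa using hi⟩ h

lemma comb {κ : ℕ → ℕ} (hκ : ∀ k, {j | κ j = k}.Infinite) {c : ℕ → ℕ}
    (d : ∀ k, Fin (c k + 1) → Fin (c k + 1) → ℝ)
    (N : ∀ j, Fin (c (κ j) + 1) → Fin (c (κ j) + 1) → ℝ)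
    (hd : ∀ k a b, 0 ≤ d k a b) (hN : ∀ j a b, 0 ≤ N j a b) (hd0 : ∀ k a, d k a a = 0)
    (hN0 : ∀ j a, N j a a = 0) (hdp : ∀ k a b, a ≠ b → 0 < d k a b)
    (hd1 : ∀ k a b, d k a b ≤ (1 / 2) ^ k)
    (H : ∀ x y : ∀ j, Fin (c (κ j) + 1), (Summable fun j => d (κ j) (x j) (y j)) ↔
      Summable fun j => N j (x j) (y j)) :
    ∃ C > 0, ∃ k0, ∀ k ≥ k0, ∃ j, κ j = k ∧ ∀ a b, N j a b ≤ C * d (κ j) a b ∧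
      d (κ j) a b ≤ C * N j a b := by
  have hδ : ∀ k, ∃ δ > 0, ∀ j, κ j = k → ∀ a b, 0 < d (κ j) a b → δ ≤ d (κ j) a b := by
    intro k
    obtain ⟨δ, h0, h1⟩ := exists_delta fun ab : Fin (c k + 1) × Fin (c k + 1) => d k ab.1 ab.2
    refine ⟨δ, h0, ?_⟩
    rintro j rfl a b h
    exact h1 (a, b) h
  have hpow : ∀ i : ℕ, (2 : ℝ) ^ i * (1 / 2) ^ i = 1 := fun i => by rw [← mul_pow]; norm_num
  obtain ⟨i1, h1⟩ := comb1 (κ := κ) (c := fun j => c (κ j)) (fun j => d (κ j)) (fun j => d (κ j)) N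
    (fun j => hd _) hN (fun j => hd0 _) (fun i => (1 / 2) ^ i) (fun _ => 1) (fun i => 2 ^ i)
    (fun i => by positivity) (fun i => by simp) (fun i => ⟨by positivity, (hpow i).ge⟩) hδ
    (fun i j hij a b => (hd1 _ _ _).trans (pow_le_pow_of_le_one (by norm_num) (by norm_num) hij))
    (fun i j a b => 2 ^ i * d (κ j) a b < N j a b)
    (fun i j a b h => ⟨hdp _ _ _ (by
      rintro rfl
      rw [hN0, hd0] at h; simp at h), by simp, h.le⟩)
    (fun x y => (H x y).1)
  obtain ⟨i2, h2⟩ := comb1 (κ := κ) (c := fun j => c (κ j)) (fun j => d (κ j)) N (fun j => d (κ j))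
    hN (fun j => hd _) hN0 (fun i => 1) (fun i => (1 / 2) ^ i) (fun i => 1)
    (fun i => by positivity) (fun i => ⟨by positivity, by simp⟩) (fun i => by simp) hδ
    (fun i j hij a b => (hd1 _ _ _).trans (pow_le_one₀ (by norm_num) (by norm_num)))
    (fun i j a b => 2 ^ i * N j a b < d (κ j) a b)
    (fun i j a b h => ⟨lt_of_le_of_lt (mul_nonneg (by positivity) (hN j a b)) h, by
      have h3 := hpow i
      have h4 : (1 / 2 : ℝ) ^ i * (2 ^ i * N j a b) ≤ (1 / 2 : ℝ) ^ i * d (κ j) a b :=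
        mul_le_mul_of_nonneg_left h.le (by positivity)
      calc N j a b = (1 / 2 : ℝ) ^ i * (2 ^ i * N j a b) := by
            rw [← mul_assoc, mul_comm ((1 / 2 : ℝ) ^ i), h3, one_mul]
        _ ≤ _ := h4, by simp⟩)
    (fun x y => (H x y).2)
  refine ⟨2 ^ i1 + 2 ^ i2, by positivity, max i1 i2, fun k hk => ?_⟩
  obtain ⟨j, hj, hj2⟩ := ((hκ k).diff ((h1 k ((le_max_left _ _).trans hk)).union
    (h2 k ((le_max_right _ _).trans hk)))).nonempty
  refine ⟨j, hj, fun a b => ?_⟩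
  simp only [Set.mem_union, Set.mem_setOf_eq, not_or, not_and, not_exists, not_lt] at hj2
  have e1 := hj2.1 hj a b
  have e2 := hj2.2 hj a b
  have := hd (κ j) a b
  have := hN j a b
  constructor
  · refine e1.trans ?_
    gcongr
    have : (0 : ℝ) ≤ 2 ^ i2 := by positivity
    linarith
  · refine e2.trans ?_
    gcongr
    have : (0 : ℝ) ≤ 2 ^ i1 := by positivity
    linarith

end EBR


namespace EBR

lemma unpair_inf (k l : ℕ) : ∃ n ≥ l, (Nat.unpair n).1 = k :=
  ⟨Nat.pair k l, Nat.right_le_pair _ _, by simp⟩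

lemma keyprop0 {X Y : Type*} [NormedAddCommGroup X] [MeasurableSpace X]
    [NormedAddCommGroup Y] [SecondCountableTopology Y]
    [MeasurableSpace Y] [BorelSpace Y] {p q : ℝ} (hp : 0 < p) (hq : 0 < q)
    {θ : (ℕ → X) → ℕ → Y} (hθ : Measurable θ)
    (hred : ∀ x y, (Summable fun n => ‖x n - y n‖ ^ p) ↔ Summable fun n => ‖θ x n - θ y n‖ ^ q)
    (c : ℕ → ℕ) (v : ∀ k, Fin (c k + 1) → X) (hv : ∀ k, Function.Injective (v k))
    (hv1 : ∀ k a b, ‖v k a - v k b‖ ^ p ≤ (1 / 2) ^ k) :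
    ∃ C > 0, ∃ k0, ∀ k ≥ k0, ∃ (I : Finset ℕ) (f : Fin (c k + 1) → ℕ → Y), ∀ a b,
      ∑ i ∈ I, ‖f a i - f b i‖ ^ q ≤ C * ‖v k a - v k b‖ ^ p ∧
      ‖v k a - v k b‖ ^ p ≤ C * ∑ i ∈ I, ‖f a i - f b i‖ ^ q := by
  classical
  let τ : ℕ → ℕ := fun n => (Nat.unpair n).1
  let ι : (∀ n, Fin (c (τ n) + 1)) → ℕ → X := fun z n => v (τ n) (z n)
  have hι : Measurable ι := by
    refine measurable_pi_lambda _ fun n => ?_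
    exact (measurable_from_top (f := v (τ n))).comp (measurable_pi_apply n)
  obtain ⟨nn, K, f, T, hnm, hκ, hF⟩ := fusion (c := fun n => c (τ n)) (θ := fun z => θ (ι z))
    (hθ.comp hι) hq (fun z z' ⟨l, hl⟩ => (hred _ _).1 (by
      refine summable_of_ne_finset_zero (s := Finset.range l) fun n hn => ?_
      have : z' n = z n := hl n (by simpa using hn)
      simp [ι, this, Real.zero_rpow hp.ne'])) τ τ unpair_inf
  have hext : ∀ x : ∀ j, Fin (c (τ (nn j)) + 1), ∃ x' : ∀ n, Fin (c (τ n) + 1),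
      ∀ j, x' (nn j) = x j := by
    intro x
    have : ∀ n, ∃ w : Fin (c (τ n) + 1), ∀ j (h : nn j = n), w = h ▸ x j := by
      intro n
      by_cases h : ∃ j, nn j = n
      · obtain ⟨j, rfl⟩ := h
        refine ⟨x j, fun j' h => ?_⟩
        obtain rfl := hnm.injective h
        rfl
      · exact ⟨0, fun j hj => absurd ⟨j, hj⟩ h⟩
    choose w hw using this
    exact ⟨w, fun j => hw _ j rfl⟩
  obtain ⟨C, hC, k0, hk⟩ := comb (κ := fun j => τ (nn j)) (c := c) (fun k => by
      refine Set.infinite_of_not_bddAbove ?_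
      rintro ⟨M, hM⟩
      obtain ⟨n, hn, h⟩ := unpair_inf k (M + 1)
      have : n ≤ M := hM (show τ (nn n) = k by rw [hκ]; exact h)
      omega)
    (fun k a b => ‖v k a - v k b‖ ^ p)
    (fun j a b => ∑ i ∈ Finset.Ico (K j) (K (j + 1)), ‖f j a i - f j b i‖ ^ q)
    (fun k a b => by positivity) (fun j a b => by positivity)
    (fun k a => by simp [Real.zero_rpow hp.ne']) (fun j a => by simp [Real.zero_rpow hq.ne'])
    (fun k a b hab => Real.rpow_pos_of_pos (norm_pos_iff.2 (sub_ne_zero.2 fun h => hab (hv k h))) _)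
    hv1 (fun x y => by
      obtain ⟨x', hx'⟩ := hext x
      obtain ⟨y', hy'⟩ := hext y
      have h := hF x' y'
      rw [← hred] at h
      simp only [hx', hy'] at h
      refine Iff.trans (Iff.trans ?_ (hnm.injective.summable_iff ?_)) h
      · simp [ι, Function.comp_def, hx', hy']
      · intro n hn
        simp only [ι, hn, if_false, sub_self, norm_zero, Real.zero_rpow hp.ne'])
  refine ⟨C, hC, k0, fun k hk0 => ?_⟩
  obtain ⟨j, rfl, h⟩ := hk k hk0
  exact ⟨_, f j, h⟩

lemma keyprop {X Y : Type*} [NormedAddCommGroup X] [NormedSpace ℝ X] [MeasurableSpace X]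
    [NormedAddCommGroup Y] [NormedSpace ℝ Y] [SecondCountableTopology Y]
    [MeasurableSpace Y] [BorelSpace Y] {p q : ℝ} (hp : 0 < p) (hq : 0 < q)
    {θ : (ℕ → X) → ℕ → Y} (hθ : Measurable θ)
    (hred : ∀ x y, (Summable fun n => ‖x n - y n‖ ^ p) ↔ Summable fun n => ‖θ x n - θ y n‖ ^ q)
    (c : ℕ → ℕ) (v : ∀ k, Fin (c k + 1) → X) (hv : ∀ k, Function.Injective (v k)) :
    ∃ C > 0, ∀ k, ∃ (I : Finset ℕ) (f : Fin (c k + 1) → ℕ → Y), ∀ a b,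
      ∑ i ∈ I, ‖f a i - f b i‖ ^ q ≤ C * ‖v k a - v k b‖ ^ p ∧
      ‖v k a - v k b‖ ^ p ≤ C * ∑ i ∈ I, ‖f a i - f b i‖ ^ q := by
  have hsc : ∀ k m : ℕ, ∃ l : ℝ, 0 < l ∧ ∀ a b, ‖l • v k a - l • v k b‖ ^ p ≤ (1 / 2 : ℝ) ^ m := by
    intro k m
    let S : ℝ := 1 + ∑ a, ∑ b, ‖v k a - v k b‖
    have hS : 0 < S := by positivity
    refine ⟨((1 / 2 : ℝ) ^ m) ^ p⁻¹ / S, by positivity, fun a b => ?_⟩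
    rw [← smul_sub, norm_smul, Real.norm_of_nonneg (by positivity)]
    have h1 : ‖v k a - v k b‖ ≤ S := by
      have h2 : ‖v k a - v k b‖ ≤ ∑ b, ‖v k a - v k b‖ :=
        Finset.single_le_sum (f := fun b => ‖v k a - v k b‖) (fun _ _ => norm_nonneg _) (Finset.mem_univ b)
      have h3 : ∑ b, ‖v k a - v k b‖ ≤ ∑ a, ∑ b, ‖v k a - v k b‖ :=
        Finset.single_le_sum (f := fun a => ∑ b, ‖v k a - v k b‖)
          (fun _ _ => by positivity) (Finset.mem_univ a)
      simp only [S]; linarith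
    have h4 : ((1 / 2 : ℝ) ^ m) ^ p⁻¹ / S * ‖v k a - v k b‖ ≤ ((1 / 2 : ℝ) ^ m) ^ p⁻¹ := by
      rw [div_mul_eq_mul_div, div_le_iff₀ hS]
      gcongr
    calc _ ≤ (((1 / 2 : ℝ) ^ m) ^ p⁻¹) ^ p := by gcongr
      _ = _ := Real.rpow_inv_rpow (by positivity) hp.ne'
  choose l hl hlv using hsc
  obtain ⟨C, hC, k0, hk⟩ := keyprop0 hp hq hθ hred (fun m => c (Nat.unpair m).1)
    (fun m a => l (Nat.unpair m).1 m • v (Nat.unpair m).1 a)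
    (fun m a b hab => hv _ (smul_right_injective _ (hl _ _).ne' hab))
    (fun m a b => hlv _ _ _ _)
  refine ⟨C, hC, fun k => ?_⟩
  obtain ⟨m, hm, rfl⟩ := unpair_inf k k0
  obtain ⟨I, f, h⟩ := hk m hm
  set L := l (Nat.unpair m).1 m with hL
  have hL0 : 0 < L := hl _ _
  refine ⟨I, fun a i => (L ^ (p / q))⁻¹ • f a i, fun a b => ?_⟩
  have e1 : ‖L • v (Nat.unpair m).1 a - L • v (Nat.unpair m).1 b‖ ^ p =
      L ^ p * ‖v (Nat.unpair m).1 a - v (Nat.unpair m).1 b‖ ^ p := by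
    rw [← smul_sub, norm_smul, Real.norm_of_nonneg hL0.le, Real.mul_rpow hL0.le (norm_nonneg _)]
  have e2 : ∑ i ∈ I, ‖(L ^ (p / q))⁻¹ • f a i - (L ^ (p / q))⁻¹ • f b i‖ ^ q =
      (L ^ p)⁻¹ * ∑ i ∈ I, ‖f a i - f b i‖ ^ q := by
    rw [Finset.mul_sum]
    refine Finset.sum_congr rfl fun i _ => ?_
    rw [← smul_sub, norm_smul, Real.norm_of_nonneg (by positivity),
      Real.mul_rpow (by positivity) (norm_nonneg _), Real.inv_rpow (by positivity),
      ← Real.rpow_mul hL0.le, div_mul_cancel₀ _ hq.ne']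
  have h3 := h a b
  rw [e1] at h3
  rw [e2]
  have hLp : 0 < L ^ p := by positivity
  constructor
  · rw [inv_mul_le_iff₀ hLp]
    linarith [h3.1]
  · rw [mul_left_comm, ← div_eq_inv_mul, le_div_iff₀ hLp]
    linarith [h3.2]

end EBR


namespace EBR

lemma le_rpow_one_div' {x y : ℝ≥0∞} {z : ℝ} (hz : 0 < z) : x ≤ y ^ (1 / z) ↔ x ^ z ≤ y := by
  rw [one_div]; exact ENNReal.le_rpow_inv_iff hz

lemma lp_convex {Ω : Type} [MeasurableSpace Ω] (μ : Measure Ω) {β : ℝ} (hβ : 1 ≤ β)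
    {ι : Type} (s : Finset ι) (g : ι → Ω → ℝ≥0∞) (hg : ∀ i, Measurable (g i)) :
    (∫⁻ x, (∑ i ∈ s, g i x) ^ β ∂μ) ^ (1 / β) ≤ ∑ i ∈ s, (∫⁻ x, g i x ^ β ∂μ) ^ (1 / β) := by
  classical
  have hβ0 : 0 < β := by linarith
  induction s using Finset.induction_on with
  | empty => simp [hβ0]
  | insert i s hi ih =>
    simp only [Finset.sum_insert hi]
    refine le_trans ?_ (add_le_add le_rfl ih)
    exact ENNReal.lintegral_Lp_add_le (hg i).aemeasurable
      (Finset.measurable_fun_sum s fun j _ => hg j).aemeasurable hβ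

lemma lp_concave {Ω : Type} [MeasurableSpace Ω] (μ : Measure Ω) {β : ℝ} (hβ : 1 ≤ β)
    {ι : Type} (s : Finset ι) (g : ι → Ω → ℝ≥0∞) (hg : ∀ i, Measurable (g i)) :
    (∑ i ∈ s, (∫⁻ x, g i x ∂μ) ^ β) ^ (1 / β) ≤ ∫⁻ x, (∑ i ∈ s, g i x ^ β) ^ (1 / β) ∂μ := by
  have hβ0 : 0 < β := by linarith
  rcases hβ.eq_or_lt with rfl | hβ1
  · simp [lintegral_finsetSum s fun i _ => hg i]
  set A := ∑ i ∈ s, (∫⁻ x, g i x ∂μ) ^ β with hA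
  by_cases h0 : A = 0
  · rw [h0]; simp [hβ0]
  by_cases hT : A = ∞
  · obtain ⟨i, hi, h⟩ := ENNReal.sum_eq_top.1 hT
    have h' : ∫⁻ x, g i x ∂μ = ∞ := by
      by_contra hne
      exact (ENNReal.rpow_ne_top_of_nonneg hβ0.le hne) h
    have : ∫⁻ x, g i x ∂μ ≤ ∫⁻ x, (∑ i ∈ s, g i x ^ β) ^ (1 / β) ∂μ := by
      refine lintegral_mono fun x => ?_
      rw [le_rpow_one_div' hβ0]
      exact Finset.single_le_sum (f := fun i => g i x ^ β) (fun _ _ => zero_le) hi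
    rw [h', top_le_iff] at this
    rw [this]; exact le_top
  have hpq : (β / (β - 1)).HolderConjugate β := (Real.HolderConjugate.conjExponent hβ1).symm
  have hfin : ∀ i ∈ s, ∫⁻ x, g i x ∂μ ≠ ∞ := fun i hi h => by
    apply hT; rw [hA]; exact ENNReal.sum_eq_top.2 ⟨i, hi, by rw [h]; simp [hβ0]⟩
  have e1 : A ≤ A ^ (1 / (β / (β - 1))) * ∫⁻ x, (∑ i ∈ s, g i x ^ β) ^ (1 / β) ∂μ := by
    calc A = ∑ i ∈ s, ∫⁻ x, (∫⁻ y, g i y ∂μ) ^ (β - 1) * g i x ∂μ := by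
          refine Finset.sum_congr rfl fun i hi => ?_
          rw [lintegral_const_mul _ (hg i)]
          by_cases hz : ∫⁻ y, g i y ∂μ = 0
          · rw [hz]; simp [hβ0]
          · rw [ENNReal.rpow_sub _ _ hz (hfin i hi), ENNReal.rpow_one]
            rw [ENNReal.div_mul_cancel hz (hfin i hi)]
      _ = ∫⁻ x, ∑ i ∈ s, (∫⁻ y, g i y ∂μ) ^ (β - 1) * g i x ∂μ :=
          (lintegral_finsetSum s fun i _ => (hg i).const_mul _).symm
      _ ≤ ∫⁻ x, A ^ (1 / (β / (β - 1))) * (∑ i ∈ s, g i x ^ β) ^ (1 / β) ∂μ := by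
          refine lintegral_mono fun x => ?_
          refine (ENNReal.inner_le_Lp_mul_Lq s _ _ hpq).trans (le_of_eq ?_)
          congr 2
          refine Finset.sum_congr rfl fun i _ => ?_
          rw [← ENNReal.rpow_mul, mul_div_cancel₀]
          linarith
      _ = _ := by
          rw [lintegral_const_mul]
          exact (Finset.measurable_fun_sum s fun j _ => (hg j).pow_const _).pow_const _
  have hB0 : A ^ (1 / (β / (β - 1))) ≠ 0 := by
    simp [ENNReal.rpow_eq_zero_iff, h0, hT]
  have hBT : A ^ (1 / (β / (β - 1))) ≠ ∞ := ENNReal.rpow_ne_top_of_nonneg (by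
    have : 0 < β - 1 := by linarith
    positivity) hT
  have e2 : A = A ^ (1 / (β / (β - 1))) * A ^ (1 / β) := by
    rw [← ENNReal.rpow_add _ _ h0 hT]
    have : 1 / (β / (β - 1)) + 1 / β = 1 := by
      have : β - 1 ≠ 0 := by linarith
      field_simp; ring
    rw [this, ENNReal.rpow_one]
  rw [e2] at e1
  nth_rewrite 2 [← e2] at e1
  exact (ENNReal.mul_le_mul_iff_right hB0 hBT).1 e1

/-- A function norm that is `t'`-convex for `t' ≤ t` and `w`-concave. -/
structure Good {S : Type} [MeasurableSpace S] (ρ : (S → ℝ≥0∞) → ℝ≥0∞) (t w : ℝ) : Prop where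
  mono : ∀ h h' : S → ℝ≥0∞, h ≤ h' → ρ h ≤ ρ h'
  homog : ∀ (c : ℝ≥0) (h : S → ℝ≥0∞), Measurable h → ρ (fun x => c * h x) = c * ρ h
  conv : ∀ (t' : ℝ), 1 ≤ t' → t' ≤ t → ∀ (ι : Type) (s : Finset ι) (h : ι → S → ℝ≥0∞),
    (∀ i, Measurable (h i)) →
    ρ (fun x => (∑ i ∈ s, h i x ^ t') ^ (1 / t')) ≤ (∑ i ∈ s, ρ (h i) ^ t') ^ (1 / t')
  conc : ∀ (ι : Type) (s : Finset ι) (h : ι → S → ℝ≥0∞), (∀ i, Measurable (h i)) →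
    (∑ i ∈ s, ρ (h i) ^ w) ^ (1 / w) ≤ ρ (fun x => (∑ i ∈ s, h i x ^ w) ^ (1 / w))

/-- Add a further `L_p` level. -/
def lev {S T : Type} [MeasurableSpace T] (ρ : (S → ℝ≥0∞) → ℝ≥0∞) (ν : Measure T) (p : ℝ) :
    (S × T → ℝ≥0∞) → ℝ≥0∞ :=
  fun h => ρ fun x => (∫⁻ y, h (x, y) ^ p ∂ν) ^ (1 / p)

lemma Good.lev {S T : Type} [MeasurableSpace S] [MeasurableSpace T] {ρ : (S → ℝ≥0∞) → ℝ≥0∞}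
    {t w p : ℝ} (hρ : Good ρ t w) (ν : Measure T) [SFinite ν] (hp : 0 < p) (htp : t ≤ p) (hpw : p ≤ w) :
    Good (lev ρ ν p) t w := by
  have hw : 0 < w := by linarith
  have hmeas : ∀ h : S × T → ℝ≥0∞, Measurable h →
      Measurable fun x => (∫⁻ y, h (x, y) ^ p ∂ν) ^ (1 / p) := fun h hh =>
    ((hh.pow_const p).lintegral_prod_right').pow_const _
  refine ⟨fun h h' hh => hρ.mono _ _ fun x => ?_, fun c h hh => ?_, fun t' h1 h2 ι s h hh => ?_,
    fun ι s h hh => ?_⟩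
  · dsimp only
    gcongr
    exact hh _
  · simp only [EBR.lev]
    rw [← hρ.homog c _ (hmeas h hh)]
    congr 1
    funext x
    simp only [ENNReal.mul_rpow_of_nonneg _ _ hp.le]
    have hm : Measurable fun y => h (x, y) ^ p := (hh.comp measurable_prodMk_left).pow_const p
    rw [lintegral_const_mul _ hm,
      ENNReal.mul_rpow_of_nonneg _ _ (by positivity), ← ENNReal.rpow_mul, mul_one_div_cancel hp.ne',
      ENNReal.rpow_one]
  · have ht0 : 0 < t' := by linarith
    refine le_trans (hρ.mono _ _ fun x => ?_) (hρ.conv t' h1 h2 ι s _ fun i => hmeas (h i) (hh i))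
    have := lp_convex ν (β := p / t') ((one_le_div ht0).2 (h2.trans htp)) s
      (fun i y => h i (x, y) ^ t') fun i => ((hh i).comp measurable_prodMk_left).pow_const t'
    dsimp only
    simp only [← ENNReal.rpow_mul] at this ⊢
    rw [le_rpow_one_div' ht0]
    simp only [← ENNReal.rpow_mul]
    rw [show t' * (p / t') = p by field_simp, show 1 / (p / t') = 1 / p * t' by field_simp,
      show p / t' = 1 / t' * p by field_simp] at this
    exact this
  · refine le_trans (hρ.conc ι s _ fun i => hmeas (h i) (hh i)) (hρ.mono _ _ fun x => ?_)
    have := lp_concave ν (β := w / p) ((one_le_div hp).2 hpw) s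
      (fun i y => h i (x, y) ^ p) fun i => ((hh i).comp measurable_prodMk_left).pow_const p
    dsimp only
    simp only [← ENNReal.rpow_mul] at this ⊢
    rw [le_rpow_one_div' hp]
    simp only [← ENNReal.rpow_mul]
    rw [show p * (w / p) = w by field_simp, show 1 / (w / p) = 1 / w * p by field_simp,
      show w / p = 1 / p * w by field_simp] at this
    exact this

lemma good_unit {t w : ℝ} : Good (S := Unit) (fun h => h ()) t w :=
  ⟨fun _ _ hh => hh (), fun _ _ _ => rfl, fun _ _ _ _ _ _ _ => le_rfl, fun _ _ _ _ => le_rfl⟩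

end EBR


namespace EBR

/-- Uniform embeddings of finite subsets of `ℓ_r` spaces into convex/concave lattices. -/
def Mdl (r α t w : ℝ) : Prop :=
  ∀ (A ι : ℕ → Type) [∀ k, Fintype (A k)] [∀ k, Nonempty (A k)] [∀ k, Fintype (ι k)]
    [∀ k, Nonempty (ι k)] (v : ∀ k, A k → ι k → ℝ), (∀ k, Function.Injective (v k)) →
    ∃ C : ℝ, 0 < C ∧ ∀ k, ∃ (S : Type) (_ : MeasurableSpace S) (ρ : (S → ℝ≥0∞) → ℝ≥0∞)
      (G : A k → S → ℝ), Good ρ t w ∧ (∀ a, Measurable (G a)) ∧ ∀ a b,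
        ρ (fun x => ‖G a x - G b x‖ₑ) ≤
          ENNReal.ofReal (C * (∑ i, |v k a i - v k b i| ^ r) ^ (α / r)) ∧
        ENNReal.ofReal ((∑ i, |v k a i - v k b i| ^ r) ^ (α / r)) ≤
          ENNReal.ofReal C * ρ (fun x => ‖G a x - G b x‖ₑ)

lemma keyprop2 {X Y : Type*} [NormedAddCommGroup X] [NormedSpace ℝ X] [MeasurableSpace X]
    [NormedAddCommGroup Y] [NormedSpace ℝ Y] [SecondCountableTopology Y]
    [MeasurableSpace Y] [BorelSpace Y] {p q r : ℝ} (hp : 0 < p) (hq : 0 < q) (hr : 0 < r)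
    {θ : (ℕ → X) → ℕ → Y} (hθ : Measurable θ)
    (hred : ∀ x y, (Summable fun n => ‖x n - y n‖ ^ p) ↔ Summable fun n => ‖θ x n - θ y n‖ ^ q)
    (hJ : ∀ (ι : Type) [Fintype ι] [Nonempty ι], ∃ J : (ι → ℝ) → X, ∀ a b,
      ‖J a - J b‖ ^ r = ∑ i, |a i - b i| ^ r)
    (A ι : ℕ → Type) [∀ k, Fintype (A k)] [∀ k, Nonempty (A k)] [∀ k, Fintype (ι k)]
    [∀ k, Nonempty (ι k)] (v : ∀ k, A k → ι k → ℝ) (hv : ∀ k, Function.Injective (v k)) :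
    ∃ C > 0, ∀ k, ∃ (I : Finset ℕ) (f : A k → ℕ → Y), ∀ a b,
      ∑ i ∈ I, ‖f a i - f b i‖ ^ q ≤ C * (∑ i, |v k a i - v k b i| ^ r) ^ (p / r) ∧
      (∑ i, |v k a i - v k b i| ^ r) ^ (p / r) ≤ C * ∑ i ∈ I, ‖f a i - f b i‖ ^ q := by
  choose J hJ using fun k => hJ (ι k)
  have hcard : ∀ k, Fintype.card (A k) = (Fintype.card (A k) - 1) + 1 := fun k =>
    (Nat.sub_add_cancel Fintype.card_pos).symm
  let e : ∀ k, A k ≃ Fin (Fintype.card (A k) - 1 + 1) := fun k => Fintype.equivFinOfCardEq (hcard k)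
  have hn : ∀ k a b, ‖J k (v k a) - J k (v k b)‖ ^ p = (∑ i, |v k a i - v k b i| ^ r) ^ (p / r) := by
    intro k a b
    rw [← hJ, ← Real.rpow_mul (norm_nonneg _), mul_div_cancel₀ _ hr.ne']
  obtain ⟨C, hC, h⟩ := keyprop hp hq hθ hred (fun k => Fintype.card (A k) - 1)
    (fun k a => J k (v k ((e k).symm a))) (fun k a b hab => by
      have h1 := hJ k (v k ((e k).symm a)) (v k ((e k).symm b))
      simp only at hab
      rw [hab, sub_self, norm_zero, Real.zero_rpow hr.ne', eq_comm,
        Finset.sum_eq_zero_iff_of_nonneg (fun i _ => by positivity)] at h1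
      refine (e k).symm.injective (hv k ?_)
      funext i
      have := h1 i (Finset.mem_univ _)
      rw [Real.rpow_eq_zero (abs_nonneg _) hr.ne', abs_eq_zero, sub_eq_zero] at this
      exact this)
  refine ⟨C, hC, fun k => ?_⟩
  obtain ⟨I, f, hf⟩ := h k
  refine ⟨I, fun a => f (e k a), fun a b => ?_⟩
  have := hf (e k a) (e k b)
  simp only [Equiv.symm_apply_apply, hn] at this
  exact this

lemma lev_calc {Ω : Type} [MeasurableSpace Ω] (μ : Measure Ω) {Y : Type*} [NormedAddCommGroup Y]
    (g : Y → Ω → ℝ) {s q u : ℝ} (hs : 0 < s) (hq : 0 < q) (hu : 0 < u)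
    (hg : ∀ y y', ∫⁻ ω, ‖g y ω - g y' ω‖ₑ ^ s ∂μ = ENNReal.ofReal (‖y - y'‖ ^ s))
    (I : Finset ℕ) (f f' : ℕ → Y) :
    lev (lev (fun h : Unit → ℝ≥0∞ => h ()) (Measure.count.restrict (I : Set ℕ)) (u * q)) μ (u * s)
      (fun z => ‖g (f z.1.2) z.2 - g (f' z.1.2) z.2‖ₑ ^ (1 / u)) =
    ENNReal.ofReal ((∑ i ∈ I, ‖f i - f' i‖ ^ q) ^ (1 / (u * q))) := by
  simp only [lev]
  rw [← ENNReal.ofReal_rpow_of_nonneg (by positivity) (by positivity)]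
  congr 1
  rw [lintegral_finset, ENNReal.ofReal_sum_of_nonneg (fun i _ => by positivity)]
  refine Finset.sum_congr rfl fun i _ => ?_
  simp only [← ENNReal.rpow_mul, Measure.count_singleton, mul_one]
  rw [show 1 / u * (u * s) = s by field_simp, hg,
    ENNReal.ofReal_rpow_of_nonneg (by positivity) (by positivity), ← Real.rpow_mul (norm_nonneg _)]
  congr 2
  field_simp

lemma final_bd {q u C D N p r α : ℝ} (hq : 0 < q) (hu : 0 < u) (hC : 0 < C) (hD : 0 ≤ D) (hN : 0 ≤ N)
    (hα : α = p / (u * q)) (h1 : N ≤ C * D ^ (p / r)) (h2 : D ^ (p / r) ≤ C * N) :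
    ENNReal.ofReal (N ^ (1 / (u * q))) ≤ ENNReal.ofReal (C ^ (1 / (u * q)) * D ^ (α / r)) ∧
    ENNReal.ofReal (D ^ (α / r)) ≤ ENNReal.ofReal (C ^ (1 / (u * q))) * ENNReal.ofReal (N ^ (1 / (u * q))) := by
  have e : D ^ (α / r) = (D ^ (p / r)) ^ (1 / (u * q)) := by
    rw [← Real.rpow_mul hD]; congr 1; rw [hα]; ring
  rw [e, ← ENNReal.ofReal_mul (by positivity), ← Real.mul_rpow hC.le (by positivity),
    ← Real.mul_rpow hC.le (by positivity)]
  exact ⟨by gcongr, by gcongr⟩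

lemma vol_ind (a b : ℝ) {u : ℝ} (hu : 0 < u) :
    ∫⁻ τ : ℝ, ‖(if τ < a then (1 : ℝ) else 0) - (if τ < b then 1 else 0)‖ₑ ^ u = ‖a - b‖ₑ := by
  wlog h : b ≤ a generalizing a b
  · rw [enorm_sub_rev a b, ← this b a (le_of_not_ge h)]
    refine lintegral_congr fun τ => ?_
    rw [enorm_sub_rev]
  have : ∀ τ : ℝ, ‖(if τ < a then (1 : ℝ) else 0) - (if τ < b then 1 else 0)‖ₑ ^ u =
      (Set.Ico b a).indicator 1 τ := by
    intro τ
    by_cases h1 : τ < a <;> by_cases h2 : τ < b <;> simp [h1, h2, Set.indicator, hu]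
    · exact absurd (h2.trans_le h) h1
  simp only [this]
  rw [lintegral_indicator_one measurableSet_Ico, Real.volume_Ico, Real.enorm_eq_ofReal (by linarith)]

lemma build1 {X Y : Type*} [NormedAddCommGroup X] [NormedSpace ℝ X] [MeasurableSpace X]
    [NormedAddCommGroup Y] [NormedSpace ℝ Y] [SecondCountableTopology Y]
    [MeasurableSpace Y] [BorelSpace Y] {p q r s : ℝ} (hp : 0 < p) (hq : 0 < q) (hr : 0 < r) (hs : 0 < s)
    {θ : (ℕ → X) → ℕ → Y} (hθ : Measurable θ)
    (hred : ∀ x y, (Summable fun n => ‖x n - y n‖ ^ p) ↔ Summable fun n => ‖θ x n - θ y n‖ ^ q)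
    (hJ : ∀ (ι : Type) [Fintype ι] [Nonempty ι], ∃ J : (ι → ℝ) → X, ∀ a b,
      ‖J a - J b‖ ^ r = ∑ i, |a i - b i| ^ r)
    {Ω : Type} [MeasurableSpace Ω] (μ : Measure Ω) [SFinite μ] (g : Y → Ω → ℝ)
    (hgm : ∀ y, Measurable (g y))
    (hg : ∀ y y', ∫⁻ ω, ‖g y ω - g y' ω‖ₑ ^ s ∂μ = ENNReal.ofReal (‖y - y'‖ ^ s))
    {t w : ℝ} (hts : t ≤ s) (htq : t ≤ q) (hsw : s ≤ w) (hqw : q ≤ w) :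
    Mdl r (p / q) t w := by
  intro A ι _ _ _ _ v hv
  obtain ⟨C, hC, h⟩ := keyprop2 hp hq hr hθ hred hJ A ι v hv
  refine ⟨C ^ (1 / (1 * q)), by positivity, fun k => ?_⟩
  obtain ⟨I, f, hf⟩ := h k
  refine ⟨(Unit × ℕ) × Ω, inferInstance,
    lev (lev (fun h : Unit → ℝ≥0∞ => h ()) (Measure.count.restrict (I : Set ℕ)) (1 * q)) μ (1 * s),
    fun a z => g (f a z.1.2) z.2, ?_, ?_, ?_⟩
  · simp only [one_mul]
    exact (good_unit.lev _ hq htq hqw).lev _ hs hts hsw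
  · intro a
    exact measurable_from_prod_countable_right fun x => hgm (f a x.2)
  · intro a b
    have := lev_calc μ g hs hq one_pos hg I (f a) (f b)
    simp only [div_one, ENNReal.rpow_one] at this
    rw [this]
    exact final_bd hq one_pos hC (by positivity) (by positivity) (by rw [one_mul]) (hf a b).1 (hf a b).2

lemma build2 {X Y : Type*} [NormedAddCommGroup X] [NormedSpace ℝ X] [MeasurableSpace X]
    [NormedAddCommGroup Y] [NormedSpace ℝ Y] [SecondCountableTopology Y]
    [MeasurableSpace Y] [BorelSpace Y] {p q r s : ℝ} (hp : 0 < p) (hq : 1 ≤ q) (hr : 0 < r) (hs : 1 ≤ s)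
    {θ : (ℕ → X) → ℕ → Y} (hθ : Measurable θ)
    (hred : ∀ x y, (Summable fun n => ‖x n - y n‖ ^ p) ↔ Summable fun n => ‖θ x n - θ y n‖ ^ q)
    (hJ : ∀ (ι : Type) [Fintype ι] [Nonempty ι], ∃ J : (ι → ℝ) → X, ∀ a b,
      ‖J a - J b‖ ^ r = ∑ i, |a i - b i| ^ r)
    {Ω : Type} [MeasurableSpace Ω] (μ : Measure Ω) [SFinite μ] (g : Y → Ω → ℝ)
    (hgm : ∀ y, Measurable (g y))
    (hg : ∀ y y', ∫⁻ ω, ‖g y ω - g y' ω‖ₑ ^ s ∂μ = ENNReal.ofReal (‖y - y'‖ ^ s))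
    {u w : ℝ} (hu : 0 < u) (hsw : u * s ≤ w) (hqw : u * q ≤ w) :
    Mdl r (p / (u * q)) u w := by
  intro A ι _ _ _ _ v hv
  have hq0 : 0 < q := by linarith
  have hs0 : 0 < s := by linarith
  obtain ⟨C, hC, h⟩ := keyprop2 hp hq0 hr hθ hred hJ A ι v hv
  refine ⟨C ^ (1 / (u * q)), by positivity, fun k => ?_⟩
  obtain ⟨I, f, hf⟩ := h k
  refine ⟨((Unit × ℕ) × Ω) × ℝ, inferInstance,
    lev (lev (lev (fun h : Unit → ℝ≥0∞ => h ()) (Measure.count.restrict (I : Set ℕ)) (u * q)) μ (u * s))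
      volume u,
    fun a z => if z.2 < g (f a z.1.1.2) z.1.2 then 1 else 0, ?_, ?_, ?_⟩
  · refine ((good_unit.lev _ (by positivity) (by nlinarith) hqw).lev _ (by positivity) (by nlinarith) hsw).lev
      _ hu le_rfl (by nlinarith)
  · intro a
    have h1 : Measurable fun z : (Unit × ℕ) × Ω => g (f a z.1.2) z.2 :=
      measurable_from_prod_countable_right fun x => hgm (f a x.2)
    exact Measurable.ite (measurableSet_lt measurable_snd (h1.comp measurable_fst)) measurable_const
      measurable_const
  · intro a b
    have := lev_calc μ g hs0 hq0 hu hg I (f a) (f b)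
    rw [lev]
    simp only [vol_ind _ _ hu]
    rw [this]
    exact final_bd hq0 hu hC (by positivity) (by positivity) rfl (hf a b).1 (hf a b).2

end EBR


namespace EBR

instance ellSp_sc (s : ℝ) [Fact (1 ≤ ENNReal.ofReal s)] : SecondCountableTopology (ellSp s) := by
  have hs : 0 < s := by
    have h := (Fact.out : (1 : ℝ≥0∞) ≤ ENNReal.ofReal s)
    by_contra hcon
    rw [ENNReal.ofReal_of_nonpos (not_lt.1 hcon)] at h
    simp at h
  have : TopologicalSpace.SeparableSpace (ellSp s) := by
    have h1 : TopologicalSpace.IsSeparable (Set.range fun f : ellSp s => f) := by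
      let S : Set (ellSp s) := ⋃ n : ℕ, Set.range fun a : Fin n → ℝ =>
        ∑ i : Fin n, lp.single (E := fun _ : ℕ => ℝ) (ENNReal.ofReal s) (i : ℕ) (a i)
      have hS : TopologicalSpace.IsSeparable S := by
        refine TopologicalSpace.IsSeparable.iUnion fun n => ?_
        refine TopologicalSpace.isSeparable_range ?_
        refine continuous_finsetSum _ fun i _ => ?_
        exact ((lp.isometry_single (E := fun _ : ℕ => ℝ) (p := ENNReal.ofReal s) (i : ℕ)).continuous).comp (continuous_apply i)
      refine hS.closure.mono ?_
      rintro _ ⟨f, rfl⟩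
      have := (lp.hasSum_single (E := fun _ : ℕ => ℝ) (p := ENNReal.ofReal s) ENNReal.ofReal_ne_top f).tendsto_sum_nat
      refine mem_closure_of_tendsto this (Eventually.of_forall fun n => ?_)
      refine Set.mem_iUnion.2 ⟨n, fun i => f i, ?_⟩
      exact (Finset.sum_range (fun i => lp.single (E := fun _ : ℕ => ℝ) (ENNReal.ofReal s) i (f i))).symm
    rw [Set.range_id'] at h1
    exact TopologicalSpace.isSeparable_univ_iff.1 h1
  exact UniformSpace.secondCountable_of_separable _

lemma ellSp_rep (s : ℝ) (hs : 1 ≤ s) [Fact (1 ≤ ENNReal.ofReal s)] (y y' : ellSp s) :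
    ∫⁻ n, ‖y n - y' n‖ₑ ^ s ∂Measure.count = ENNReal.ofReal (‖y - y'‖ ^ s) := by
  have hs0 : 0 < s := by linarith
  have e : (ENNReal.ofReal s).toReal = s := ENNReal.toReal_ofReal hs0.le
  have h := lp.hasSum_norm (p := ENNReal.ofReal s) (by rw [e]; exact hs0) (y - y')
  rw [e] at h
  rw [lintegral_count, ← h.tsum_eq, ENNReal.ofReal_tsum_of_nonneg (fun n => by positivity) h.summable]
  refine tsum_congr fun n => ?_
  rw [← ENNReal.ofReal_rpow_of_nonneg (norm_nonneg _) hs0.le, ofReal_norm]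
  rfl

lemma LSp_rep (s : ℝ) (hs : 1 ≤ s) [Fact (1 ≤ ENNReal.ofReal s)] (y y' : LSp s) :
    ∫⁻ x, ‖y x - y' x‖ₑ ^ s ∂((volume : Measure ℝ).restrict (Set.Icc 0 1)) = ENNReal.ofReal (‖y - y'‖ ^ s) := by
  have hs0 : 0 < s := by linarith
  have e : (ENNReal.ofReal s).toReal = s := ENNReal.toReal_ofReal hs0.le
  have h0 : ENNReal.ofReal s ≠ 0 := by simpa using hs0
  rw [← ENNReal.ofReal_rpow_of_nonneg (norm_nonneg _) hs0.le, ofReal_norm, Lp.enorm_def,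
    eLpNorm_eq_lintegral_rpow_enorm_toReal h0 ENNReal.ofReal_ne_top, e, ← ENNReal.rpow_mul,
    one_div_mul_cancel hs0.ne', ENNReal.rpow_one]
  refine lintegral_congr_ae ?_
  filter_upwards [Lp.coeFn_sub y y'] with x hx
  rw [hx]; rfl

lemma ellSp_J (r : ℝ) (hr : 1 ≤ r) [Fact (1 ≤ ENNReal.ofReal r)] (ι : Type) [Fintype ι] [Nonempty ι] :
    ∃ J : (ι → ℝ) → ellSp r, ∀ a b, ‖J a - J b‖ ^ r = ∑ i, |a i - b i| ^ r := by
  classical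
  have hr0 : 0 < r := by linarith
  have e : (ENNReal.ofReal r).toReal = r := ENNReal.toReal_ofReal hr0.le
  let φ : ι → ℕ := fun i => (Fintype.equivFin ι i : ℕ)
  have hφ : Function.Injective φ := fun i j h => (Fintype.equivFin ι).injective (Fin.ext h)
  have hmem : ∀ a : ι → ℝ, Memℓp (Function.extend φ a 0 : ℕ → ℝ) (ENNReal.ofReal r) := by
    intro a
    refine memℓp_gen (summable_of_ne_finset_zero (s := Finset.univ.image φ) fun n hn => ?_)
    rw [Function.extend_apply']
    · rw [e]; simp [hr0.ne']
    · rintro ⟨i, rfl⟩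
      exact hn (Finset.mem_image_of_mem _ (Finset.mem_univ _))
  let J : (ι → ℝ) → ellSp r := fun a => ⟨(Function.extend φ a 0 : ℕ → ℝ), hmem a⟩
  refine ⟨J, fun a b => ?_⟩
  have h := lp.hasSum_norm (p := ENNReal.ofReal r) (by rw [e]; exact hr0) (J a - J b)
  rw [e] at h
  refine h.unique ?_
  have h2 : HasSum (fun i => |a i - b i| ^ r) (∑ i, |a i - b i| ^ r) := hasSum_fintype _
  have h3 : ∀ n, (J a - J b) n = (Function.extend φ a 0 : ℕ → ℝ) n - (Function.extend φ b 0 : ℕ → ℝ) n :=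
    fun n => rfl
  refine (hφ.hasSum_iff ?_).1 ?_
  · intro n hn
    rw [h3, Function.extend_apply' _ _ _ (by simpa using hn), Function.extend_apply' _ _ _ (by simpa using hn)]
    simp [hr0.ne']
  · convert h2 using 2 with i
    simp [h3, hφ.extend_apply]

lemma LSp_J (r : ℝ) (hr : 1 ≤ r) [Fact (1 ≤ ENNReal.ofReal r)] (ι : Type) [Fintype ι] [Nonempty ι] :
    ∃ J : (ι → ℝ) → LSp r, ∀ a b, ‖J a - J b‖ ^ r = ∑ i, |a i - b i| ^ r := by
  classical
  have hr0 : 0 < r := by linarith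
  let μ := (volume : Measure ℝ).restrict (Set.Icc 0 1)
  let _ : MeasurableSpace ι := ⊤
  have : ∃ φ : ℝ → ι, Measurable φ ∧ ∀ i, μ (φ ⁻¹' {i}) ≠ 0 := by
    let n := Fintype.card ι
    have hn : 0 < n := Fintype.card_pos
    have hn' : (0 : ℝ) < n := by exact_mod_cast hn
    let e := Fintype.equivFin ι
    let ψ : ℕ → ι := fun k => if h : k < n then e.symm ⟨k, h⟩ else e.symm ⟨0, hn⟩
    refine ⟨fun x => ψ ⌊n * x⌋₊, (measurable_from_top (f := ψ)).comp
      (Nat.measurable_floor.comp (measurable_const_mul _)), fun i => ?_⟩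
    have hsub : Set.Ioo ((e i : ℕ) / n : ℝ) (((e i : ℕ) + 1) / n) ⊆
        (fun x => ψ ⌊n * x⌋₊) ⁻¹' {i} := by
      intro x hx
      have h1 := (div_lt_iff₀ hn').1 hx.1
      have h2 := (lt_div_iff₀ hn').1 hx.2
      have hx0 : 0 ≤ (n : ℝ) * x := by
        have : (0 : ℝ) ≤ (e i : ℕ) := Nat.cast_nonneg _
        nlinarith
      have hfl : ⌊n * x⌋₊ = (e i : ℕ) := by
        rw [Nat.floor_eq_iff hx0]
        constructor <;> nlinarith
      have h3 : (e i : ℕ) < n := (e i).2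
      simp only [Set.mem_preimage, Set.mem_singleton_iff, hfl, ψ, h3, dif_pos]
      simp
    have hsub2 : Set.Ioo ((e i : ℕ) / n : ℝ) (((e i : ℕ) + 1) / n) ⊆ Set.Icc 0 1 := by
      intro x hx
      have h3 : (((e i : ℕ) : ℝ) + 1) / n ≤ 1 := by
        rw [div_le_one hn']
        exact_mod_cast (e i).2
      exact ⟨le_trans (by positivity) hx.1.le, hx.2.le.trans h3⟩
    have hpos : 0 < μ (Set.Ioo ((e i : ℕ) / n : ℝ) (((e i : ℕ) + 1) / n)) := by
      simp only [μ]
      rw [Measure.restrict_apply measurableSet_Ioo, Set.inter_eq_left.2 hsub2, Real.volume_Ioo,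
        ENNReal.ofReal_pos, ← sub_div]
      have : ((e i : ℕ) : ℝ) + 1 - (e i : ℕ) = 1 := by ring
      rw [this]; positivity
    exact (hpos.trans_le (measure_mono hsub)).ne'
  obtain ⟨φ, hφ, hpos⟩ := this
  let m : ι → ℝ := fun i => (μ (φ ⁻¹' {i})).toReal
  have hm : ∀ i, 0 < m i := fun i => ENNReal.toReal_pos (hpos i) (measure_ne_top _ _)
  let F : (ι → ℝ) → ℝ → ℝ := fun a x => a (φ x) * (m (φ x)) ^ (-1 / r)
  have hFm : ∀ a, Measurable (F a) := fun a =>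
    (measurable_from_top (f := fun i => a i * (m i) ^ (-1 / r))).comp hφ
  have hF : ∀ a, MemLp (F a) (ENNReal.ofReal r) μ := fun a => by
    refine MemLp.of_bound (hFm a).aestronglyMeasurable (∑ i, ‖a i * (m i) ^ (-1 / r)‖) (ae_of_all _ fun x => ?_)
    exact Finset.single_le_sum (f := fun i => ‖a i * (m i) ^ (-1 / r)‖) (fun _ _ => norm_nonneg _) (Finset.mem_univ (φ x))
  let J : (ι → ℝ) → LSp r := fun a => (hF a).toLp (F a)
  refine ⟨J, fun a b => ?_⟩
  have h1 := LSp_rep r hr (J a) (J b)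
  have h2 : ∫⁻ x, ‖J a x - J b x‖ₑ ^ r ∂μ = ∫⁻ x, ‖F a x - F b x‖ₑ ^ r ∂μ := by
    refine lintegral_congr_ae ?_
    filter_upwards [(hF a).coeFn_toLp, (hF b).coeFn_toLp] with x ha hb
    simp only [J]
    rw [ha, hb]
  have h3 : ∫⁻ x, ‖F a x - F b x‖ₑ ^ r ∂μ = ENNReal.ofReal (∑ i, |a i - b i| ^ r) := by
    have : ∫⁻ x, ‖F a x - F b x‖ₑ ^ r ∂μ =
        ∫⁻ i, ‖a i * (m i) ^ (-1 / r) - b i * (m i) ^ (-1 / r)‖ₑ ^ r ∂(μ.map φ) := by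
      rw [lintegral_map measurable_from_top hφ]
    rw [this, lintegral_fintype, ENNReal.ofReal_sum_of_nonneg (fun i _ => by positivity)]
    refine Finset.sum_congr rfl fun i _ => ?_
    rw [Measure.map_apply hφ trivial, ← ENNReal.ofReal_toReal (measure_ne_top μ (φ ⁻¹' {i})),
      ← sub_mul, Real.enorm_eq_ofReal_abs, ENNReal.ofReal_rpow_of_nonneg (by positivity) hr0.le,
      ← ENNReal.ofReal_mul (by positivity), abs_mul, abs_of_nonneg (a := m i ^ (-1 / r)) (by have := hm i; positivity),
      Real.mul_rpow (by positivity) (by have := hm i; positivity), ← Real.rpow_mul (hm i).le,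
      div_mul_cancel₀ _ hr0.ne', mul_assoc]
    rw [show (μ (φ ⁻¹' {i})).toReal = m i from rfl, Real.rpow_neg_one, inv_mul_cancel₀ (hm i).ne', mul_one]
  rw [h2, h3] at h1
  have := congrArg ENNReal.toReal h1
  rw [ENNReal.toReal_ofReal (by positivity), ENNReal.toReal_ofReal (by positivity)] at this
  exact this.symm

end EBR


namespace EBR

lemma growth {a b K : ℝ} (h : ∀ n : ℕ, 1 ≤ n → (n : ℝ) ^ a ≤ K * (n : ℝ) ^ b) : a ≤ b := by
  by_contra hab
  push Not at hab
  have h1 : Tendsto (fun n : ℕ => (n : ℝ) ^ (a - b)) atTop atTop :=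
    (tendsto_rpow_atTop (by linarith)).comp tendsto_natCast_atTop_atTop
  obtain ⟨n, hn, hn1⟩ := ((h1.eventually_gt_atTop K).and (eventually_ge_atTop 1)).exists
  have hn0 : (0 : ℝ) < n := by exact_mod_cast hn1
  have := h n hn1
  rw [Real.rpow_sub hn0, lt_div_iff₀ (by positivity)] at hn
  linarith

lemma Good.tri {S : Type} [MeasurableSpace S] {ρ : (S → ℝ≥0∞) → ℝ≥0∞} {t w : ℝ} (hρ : Good ρ t w)
    (ht : 1 ≤ t) {ι : Type} (s : Finset ι) (g : ι → S → ℝ) (hg : ∀ i, Measurable (g i)) :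
    ρ (fun x => ‖∑ i ∈ s, g i x‖ₑ) ≤ ∑ i ∈ s, ρ (fun x => ‖g i x‖ₑ) := by
  have := hρ.conv 1 le_rfl ht ι s (fun i x => ‖g i x‖ₑ) (fun i => (hg i).enorm)
  simp only [div_one, ENNReal.rpow_one] at this
  exact (hρ.mono _ _ fun x => enorm_sum_le _ _).trans this

lemma Good.tri2 {S : Type} [MeasurableSpace S] {ρ : (S → ℝ≥0∞) → ℝ≥0∞} {t w : ℝ} (hρ : Good ρ t w)
    (ht : 1 ≤ t) {X Y : S → ℝ} (hX : Measurable X) (hY : Measurable Y) :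
    ρ (fun x => ‖X x - Y x‖ₑ) ≤ ρ (fun x => ‖X x‖ₑ) + ρ (fun x => ‖Y x‖ₑ) := by
  have := hρ.conv 1 le_rfl ht Bool Finset.univ (fun i x => if i then ‖X x‖ₑ else ‖Y x‖ₑ)
    (fun i => by cases i <;> simp <;> fun_prop)
  simp only [div_one, ENNReal.rpow_one] at this
  refine (hρ.mono _ _ fun x => ?_).trans (this.trans ?_)
  · simpa using enorm_sub_le
  · simp

lemma fin_tele (n : ℕ) (F : Fin (n + 1) → ℝ) :
    ∑ i : Fin n, (F i.succ - F i.castSucc) = F (Fin.last n) - F 0 := by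
  rw [Finset.sum_sub_distrib]
  have h1 := Fin.sum_univ_succ F
  have h2 := Fin.sum_univ_castSucc F
  linarith

theorem T1 {r α t w : ℝ} (hr : 0 < r) (ht : 1 ≤ t) (H : Mdl r α t w) : α ≤ 1 := by
  obtain ⟨C, hC, h⟩ := H (fun k => Fin (k + 1)) (fun _ => Unit) (fun k a _ => (a : ℕ))
    (fun k a b hab => by
      have := congrFun hab ()
      simp at this
      exact Fin.ext this)
  refine growth (K := C * C) fun n hn => ?_
  rw [Real.rpow_one]
  obtain ⟨S, _, ρ, G, hρ, hG, hb⟩ := h n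
  have hd : ∀ x : ℝ, 0 ≤ x → (x ^ r) ^ (α / r) = x ^ α := fun x hx => by
    rw [← Real.rpow_mul hx, mul_div_cancel₀ _ hr.ne']
  simp only [Finset.univ_unique, Finset.sum_singleton, hd _ (abs_nonneg _)] at hb
  have h1 := (hb (Fin.last n) 0).2
  have h2 : ∀ x, G (Fin.last n) x - G 0 x = ∑ i : Fin n, (G i.succ x - G i.castSucc x) := by
    intro x
    exact (fin_tele n fun i => G i x).symm
  have h3 := hρ.tri ht Finset.univ (fun (i : Fin n) x => G i.succ x - G i.castSucc x)
    (fun i => (hG _).sub (hG _))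
  have h4 : ∑ i : Fin n, ρ (fun x => ‖G i.succ x - G i.castSucc x‖ₑ) ≤ n * ENNReal.ofReal C := by
    have : ∀ i : Fin n, ρ (fun x => ‖G i.succ x - G i.castSucc x‖ₑ) ≤ ENNReal.ofReal C := by
      intro i
      refine (hb _ _).1.trans (le_of_eq ?_)
      simp
    refine (Finset.sum_le_card_nsmul _ _ _ fun i _ => this i).trans ?_
    simp
  simp only [h2] at h1
  have h5 := h1.trans (mul_le_mul_right (h3.trans h4) _)
  rw [← ENNReal.ofReal_natCast, ← ENNReal.ofReal_mul (by positivity),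
    ← ENNReal.ofReal_mul hC.le, ENNReal.ofReal_le_ofReal_iff (by positivity)] at h5
  simp at h5
  linarith

/-- scalar two point inequality -/
lemma scalar_two (t w : ℝ) (ht : 1 ≤ t) (ht2 : t ≤ 2) (hw : 2 ≤ w) : ∃ K : ℝ, 0 < K ∧ ∀ a b : ℝ,
    ((|a + b| ^ w + |a - b| ^ w) / 2) ^ (1 / w) ≤ (|a| ^ t + K * |b| ^ t) ^ (1 / t) := by
  have ht0 : 0 < t := by linarith
  have hw0 : 0 < w := by linarith
  refine ⟨4 + w * Real.exp w, by positivity, fun a b => ?_⟩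
  rcases le_total |a| |b| with hab | hab
  · have h1 : ((|a + b| ^ w + |a - b| ^ w) / 2) ^ (1 / w) ≤ 2 * |b| := by
      have e1 : |a + b| ≤ 2 * |b| := (abs_add_le _ _).trans (by linarith)
      have e2 : |a - b| ≤ 2 * |b| := (abs_sub _ _).trans (by linarith)
      calc _ ≤ (((2 * |b|) ^ w + (2 * |b|) ^ w) / 2) ^ (1 / w) := by gcongr
        _ = ((2 * |b|) ^ w) ^ (1 / w) := by congr 1; ring
        _ = _ := by rw [← Real.rpow_mul (by positivity), mul_one_div_cancel hw0.ne', Real.rpow_one]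
    refine h1.trans ?_
    rw [one_div, Real.le_rpow_inv_iff_of_pos (by positivity) (by positivity) ht0,
      Real.mul_rpow (by norm_num) (abs_nonneg _)]
    have e3 : (2 : ℝ) ^ t ≤ 4 := by
      calc (2 : ℝ) ^ t ≤ 2 ^ (2 : ℝ) := Real.rpow_le_rpow_of_exponent_le (by norm_num) ht2
        _ = 4 := by norm_num
    have e4 : 0 ≤ |b| ^ t := by positivity
    have e5 : 0 ≤ |a| ^ t := by positivity
    have e6 : 0 ≤ w * Real.exp w := by positivity
    nlinarith [mul_nonneg e6 e4]
  · rcases eq_or_ne a 0 with rfl | ha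
    · have : b = 0 := by simpa using hab
      subst this
      simp [Real.zero_rpow hw0.ne', Real.zero_rpow ht0.ne', Real.zero_rpow (inv_pos.2 hw0).ne',
        Real.zero_rpow (inv_pos.2 ht0).ne']
    set x := b / a with hx
    have hb : b = a * x := by rw [hx]; field_simp
    have hx1 : |x| ≤ 1 := by rw [hx, abs_div]; exact div_le_one_of_le₀ hab (abs_nonneg _)
    have hx2 := abs_le.1 hx1
    have hap : 0 < |a| := abs_pos.2 ha
    have e1 : (|a + b| ^ w + |a - b| ^ w) / 2 = |a| ^ w * (((1 + x) ^ w + (1 - x) ^ w) / 2) := by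
      rw [hb, show a + a * x = a * (1 + x) by ring, show a - a * x = a * (1 - x) by ring,
        abs_mul, abs_mul, Real.mul_rpow hap.le (abs_nonneg _), Real.mul_rpow hap.le (abs_nonneg _),
        abs_of_nonneg (show 0 ≤ 1 + x by linarith), abs_of_nonneg (show 0 ≤ 1 - x by linarith)]
      ring
    have e2 : ((1 + x) ^ w + (1 - x) ^ w) / 2 ≤ Real.exp ((w * x) ^ 2 / 2) := by
      refine le_trans ?_ (Real.cosh_le_exp_half_sq _)
      rw [Real.cosh_eq]
      have f1 : (1 + x) ^ w ≤ Real.exp (w * x) := by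
        calc (1 + x) ^ w ≤ (Real.exp x) ^ w :=
              Real.rpow_le_rpow (by linarith) (by linarith [Real.add_one_le_exp x]) hw0.le
          _ = _ := by rw [← Real.exp_mul, mul_comm]
      have f2 : (1 - x) ^ w ≤ Real.exp (-(w * x)) := by
        calc (1 - x) ^ w ≤ (Real.exp (-x)) ^ w :=
              Real.rpow_le_rpow (by linarith) (by linarith [Real.add_one_le_exp (-x)]) hw0.le
          _ = _ := by rw [← Real.exp_mul]; congr 1; ring
      linarith
    have e3 : Real.exp (w * x ^ 2 / 2 * t) ≤ 1 + w * Real.exp w * |x| ^ t := by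
      set y := w * x ^ 2 / 2 * t with hy
      have hxx : x ^ 2 ≤ 1 := by rw [← sq_abs]; exact pow_le_one₀ (abs_nonneg _) hx1
      have hxt : x ^ 2 ≤ |x| ^ t := by
        rw [← sq_abs, ← Real.rpow_natCast]
        rcases (abs_nonneg x).eq_or_lt with h0 | h0
        · rw [← h0, Real.zero_rpow ht0.ne']; simp
        · exact Real.rpow_le_rpow_of_exponent_ge h0 hx1 (by simpa using ht2)
      have hy0 : 0 ≤ y := by positivity
      have hyx : y ≤ w * x ^ 2 := by
        have : 0 ≤ w * x ^ 2 := by positivity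
        nlinarith
      have hyw : y ≤ w := hyx.trans (by nlinarith)
      have g1 : Real.exp y ≤ 1 + y * Real.exp y := by
        have := Real.add_one_le_exp (-y)
        have h2 : Real.exp y * Real.exp (-y) = 1 := by rw [← Real.exp_add]; simp
        nlinarith [Real.exp_pos y]
      calc Real.exp y ≤ 1 + y * Real.exp y := g1
        _ ≤ 1 + w * |x| ^ t * Real.exp w := by
            gcongr
            exact hyx.trans (by gcongr)
        _ = _ := by ring
    rw [e1, Real.mul_rpow (by positivity) (by
      have : 0 ≤ 1 + x := by linarith
      have : 0 ≤ 1 - x := by linarith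
      positivity), ← Real.rpow_mul hap.le, mul_one_div_cancel hw0.ne', Real.rpow_one]
    have e4 : |a| ^ t + (4 + w * Real.exp w) * |b| ^ t = |a| ^ t * (1 + (4 + w * Real.exp w) * |x| ^ t) := by
      rw [hb, abs_mul, Real.mul_rpow hap.le (abs_nonneg _)]; ring
    rw [e4, Real.mul_rpow (by positivity) (by positivity), ← Real.rpow_mul hap.le,
      mul_one_div_cancel ht0.ne', Real.rpow_one]
    gcongr
    calc (((1 + x) ^ w + (1 - x) ^ w) / 2) ^ (1 / w) ≤ (Real.exp ((w * x) ^ 2 / 2)) ^ (1 / w) := by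
          have : 0 ≤ 1 + x := by linarith
          have : 0 ≤ 1 - x := by linarith
          gcongr
      _ = Real.exp (w * x ^ 2 / 2) := by
          rw [← Real.exp_mul]; congr 1; field_simp
      _ = (Real.exp (w * x ^ 2 / 2 * t)) ^ (1 / t) := by
          rw [← Real.exp_mul]; congr 1; field_simp
      _ ≤ (1 + w * Real.exp w * |x| ^ t) ^ (1 / t) := by gcongr
      _ ≤ _ := by
          gcongr
          linarith

end EBR


namespace EBR

lemma enorm_rpow' (a : ℝ) {w : ℝ} (hw : 0 ≤ w) : ‖a‖ₑ ^ w = ENNReal.ofReal (|a| ^ w) := by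
  rw [Real.enorm_eq_ofReal_abs, ENNReal.ofReal_rpow_of_nonneg (abs_nonneg _) hw]

lemma two_pt (t w : ℝ) (ht : 1 ≤ t) (ht2 : t ≤ 2) (hw : 2 ≤ w) : ∃ K : ℝ≥0∞, K ≠ ∞ ∧
    ∀ (S : Type) [MeasurableSpace S] (ρ : (S → ℝ≥0∞) → ℝ≥0∞), Good ρ t w →
    ∀ X Y : S → ℝ, Measurable X → Measurable Y →
    ρ (fun x => ‖X x + Y x‖ₑ) ^ t + ρ (fun x => ‖X x - Y x‖ₑ) ^ t ≤
      2 * (ρ (fun x => ‖X x‖ₑ) ^ t + K * ρ (fun x => ‖Y x‖ₑ) ^ t) := by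
  have ht0 : 0 < t := by linarith
  have hw0 : 0 < w := by linarith
  obtain ⟨K, hK, hsc⟩ := scalar_two t w ht ht2 hw
  refine ⟨ENNReal.ofReal K, ENNReal.ofReal_ne_top, fun S _ ρ hρ X Y hX hY => ?_⟩
  set P := ρ (fun x => ‖X x + Y x‖ₑ)
  set M := ρ (fun x => ‖X x - Y x‖ₑ)
  let c : ℝ≥0 := (1 / 2 : ℝ≥0) ^ (1 / w)
  have hc : (c : ℝ≥0∞) ^ w = 2⁻¹ := by
    rw [← ENNReal.coe_rpow_of_nonneg _ hw0.le]
    simp only [c]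
    rw [← NNReal.rpow_mul, one_div_mul_cancel hw0.ne', NNReal.rpow_one]
    simp
  let c' : ℝ≥0 := (Real.toNNReal K) ^ (1 / t)
  have hc' : (c' : ℝ≥0∞) ^ t = ENNReal.ofReal K := by
    rw [← ENNReal.coe_rpow_of_nonneg _ ht0.le]
    simp only [c']
    rw [← NNReal.rpow_mul, one_div_mul_cancel ht0.ne', NNReal.rpow_one]
    rfl
  have s1 : (2⁻¹ * P ^ t + 2⁻¹ * M ^ t) ^ (w / t) ≤ 2⁻¹ * P ^ w + 2⁻¹ * M ^ w := by
    refine (ENNReal.rpow_arith_mean_le_arith_mean2_rpow _ _ _ _ ENNReal.inv_two_add_inv_two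
      ((one_le_div ht0).2 (by linarith))).trans (le_of_eq ?_)
    simp only [← ENNReal.rpow_mul]
    rw [mul_div_cancel₀ _ ht0.ne']
  have s2 : (2⁻¹ * P ^ w + 2⁻¹ * M ^ w) ^ (1 / w) ≤
      ρ (fun x => (2⁻¹ * ‖X x + Y x‖ₑ ^ w + 2⁻¹ * ‖X x - Y x‖ₑ ^ w) ^ (1 / w)) := by
    have h1 : Measurable fun x => ‖X x + Y x‖ₑ := (hX.add hY).enorm
    have h2 : Measurable fun x => ‖X x - Y x‖ₑ := (hX.sub hY).enorm
    have := hρ.conc Bool Finset.univ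
      (fun i => if i then (fun x => c * ‖X x + Y x‖ₑ) else (fun x => c * ‖X x - Y x‖ₑ))
      (fun i => by cases i <;> simp <;> fun_prop)
    simp only [Fintype.sum_bool, if_true, Bool.false_eq_true, if_false, hρ.homog c _ h1, hρ.homog c _ h2,
      ENNReal.mul_rpow_of_nonneg _ _ hw0.le, hc] at this
    exact this
  have s3 : ρ (fun x => (2⁻¹ * ‖X x + Y x‖ₑ ^ w + 2⁻¹ * ‖X x - Y x‖ₑ ^ w) ^ (1 / w)) ≤
      ρ (fun x => (‖X x‖ₑ ^ t + ENNReal.ofReal K * ‖Y x‖ₑ ^ t) ^ (1 / t)) := by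
    refine hρ.mono _ _ fun x => ?_
    have h2 : (2⁻¹ : ℝ≥0∞) = ENNReal.ofReal (1 / 2) := by
      rw [ENNReal.ofReal_div_of_pos (by norm_num)]; simp
    simp only [enorm_rpow' _ hw0.le, enorm_rpow' _ ht0.le, h2]
    rw [← ENNReal.ofReal_mul (by positivity), ← ENNReal.ofReal_mul (by positivity),
      ← ENNReal.ofReal_mul (by positivity), ← ENNReal.ofReal_add (by positivity) (by positivity),
      ← ENNReal.ofReal_add (by positivity) (by positivity),
      ENNReal.ofReal_rpow_of_nonneg (by positivity) (by positivity),
      ENNReal.ofReal_rpow_of_nonneg (by positivity) (by positivity)]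
    refine ENNReal.ofReal_le_ofReal (le_trans (le_of_eq ?_) (hsc (X x) (Y x)))
    congr 1; ring
  have s4 : ρ (fun x => (‖X x‖ₑ ^ t + ENNReal.ofReal K * ‖Y x‖ₑ ^ t) ^ (1 / t)) ≤
      (ρ (fun x => ‖X x‖ₑ) ^ t + ENNReal.ofReal K * ρ (fun x => ‖Y x‖ₑ) ^ t) ^ (1 / t) := by
    have h1 : Measurable fun x => ‖X x‖ₑ := hX.enorm
    have h2 : Measurable fun x => ‖Y x‖ₑ := hY.enorm
    have := hρ.conv t ht le_rfl Bool Finset.univ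
      (fun i => if i then (fun x => ‖X x‖ₑ) else (fun x => c' * ‖Y x‖ₑ))
      (fun i => by cases i <;> simp <;> fun_prop)
    simp only [Fintype.sum_bool, if_true, Bool.false_eq_true, if_false, hρ.homog c' _ h2,
      ENNReal.mul_rpow_of_nonneg _ _ ht0.le, hc'] at this
    exact this
  have s5 : 2⁻¹ * P ^ t + 2⁻¹ * M ^ t ≤ ρ (fun x => ‖X x‖ₑ) ^ t + ENNReal.ofReal K * ρ (fun x => ‖Y x‖ₑ) ^ t := by
    have := (ENNReal.rpow_le_rpow s1 (show 0 ≤ 1 / w by positivity)).trans (s2.trans (s3.trans s4))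
    have := ENNReal.rpow_le_rpow this ht0.le
    rw [← ENNReal.rpow_mul, ← ENNReal.rpow_mul, ← ENNReal.rpow_mul, one_div_mul_cancel ht0.ne', ENNReal.rpow_one,
      show w / t * (1 / w * t) = 1 by field_simp, ENNReal.rpow_one] at this
    exact this
  calc P ^ t + M ^ t = 2 * (2⁻¹ * P ^ t + 2⁻¹ * M ^ t) := by
        rw [mul_add, ← mul_assoc, ← mul_assoc, ENNReal.mul_inv_cancel (by norm_num) (by norm_num), one_mul, one_mul]
    _ ≤ _ := by gcongr

lemma mart {t w : ℝ} (ht : 0 < t) {S : Type} [MeasurableSpace S] {ρ : (S → ℝ≥0∞) → ℝ≥0∞} (hρ : Good ρ t w)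
    {K : ℝ≥0∞}
    (h2 : ∀ X Y : S → ℝ, Measurable X → Measurable Y →
      ρ (fun x => ‖X x + Y x‖ₑ) ^ t + ρ (fun x => ‖X x - Y x‖ₑ) ^ t ≤
      2 * (ρ (fun x => ‖X x‖ₑ) ^ t + K * ρ (fun x => ‖Y x‖ₑ) ^ t))
    {Ω : Type} [Fintype Ω] (n : ℕ) (T : Fin n → Ω → Ω) (hT : ∀ i, Function.Involutive (T i))
    (s : Fin n → Ω → ℝ) (y : Fin n → Ω → S → ℝ) (hy : ∀ i ω, Measurable (y i ω))
    (hs1 : ∀ i ω, s i ω = 1 ∨ s i ω = -1)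
    (hs : ∀ i ω, s i (T i ω) = - s i ω) (hs' : ∀ i j ω, j < i → s j (T i ω) = s j ω)
    (hyT : ∀ i j ω, j ≤ i → y j (T i ω) = y j ω) :
    ∑ ω, ρ (fun x => ‖∑ i, s i ω * y i ω x‖ₑ) ^ t ≤ K * ∑ i, ∑ ω, ρ (fun x => ‖y i ω x‖ₑ) ^ t := by
  induction n with
  | zero =>
    have h0 : ρ (fun _ => 0) = 0 := by
      have := hρ.homog 0 (fun _ => 0) measurable_const
      simpa using this
    simp [h0, ht]
  | succ n ih =>
    have ih' := ih (fun i => T i.castSucc) (fun i => hT _) (fun i => s i.castSucc) (fun i => y i.castSucc)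
      (fun i => hy _) (fun i => hs1 _) (fun i => hs _) (fun i j ω h => hs' _ _ ω (by simpa using h))
      (fun i j ω h => hyT _ _ ω (by simpa using h))
    let N : Ω → S → ℝ := fun ω x => ∑ i : Fin n, s i.castSucc ω * y i.castSucc ω x
    have hN : ∀ ω, Measurable (N ω) := fun ω =>
      Finset.measurable_fun_sum _ fun i _ => (hy _ _).const_mul _
    let l := Fin.last n
    have hNT : ∀ ω, N (T l ω) = N ω := by
      intro ω
      funext x
      refine Finset.sum_congr rfl fun i _ => ?_
      rw [hs' l _ ω (Fin.castSucc_lt_last i), hyT l _ ω (Fin.castSucc_lt_last i).le]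
    have e1 : ∀ ω, ρ (fun x => ‖∑ i, s i ω * y i ω x‖ₑ) ^ t +
        ρ (fun x => ‖∑ i, s i (T l ω) * y i (T l ω) x‖ₑ) ^ t ≤
        2 * (ρ (fun x => ‖N ω x‖ₑ) ^ t + K * ρ (fun x => ‖y l ω x‖ₑ) ^ t) := by
      intro ω
      have a1 : ∀ x, ∑ i, s i ω * y i ω x = N ω x + s l ω * y l ω x := fun x => by
        rw [Fin.sum_univ_castSucc]
      have a2 : ∀ x, ∑ i, s i (T l ω) * y i (T l ω) x = N ω x - s l ω * y l ω x := fun x => by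
        rw [Fin.sum_univ_castSucc, hs l, hyT l l ω le_rfl, ← hNT ω]; simp only [N]; ring
      simp only [a1, a2]
      have a3 := h2 (N ω) (y l ω) (hN ω) (hy _ _)
      rcases hs1 l ω with h | h
      · simpa [h] using a3
      · simp only [h, neg_mul, one_mul, sub_neg_eq_add, ← sub_eq_add_neg]
        rw [add_comm]; exact a3
    have e2 : ∑ ω, ρ (fun x => ‖∑ i, s i (T l ω) * y i (T l ω) x‖ₑ) ^ t =
        ∑ ω, ρ (fun x => ‖∑ i, s i ω * y i ω x‖ₑ) ^ t :=
      Equiv.sum_comp (hT l).toPerm fun ω => ρ (fun x => ‖∑ i, s i ω * y i ω x‖ₑ) ^ t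
    have e3 := Finset.sum_le_sum fun ω (_ : ω ∈ Finset.univ) => e1 ω
    rw [Finset.sum_add_distrib, e2, ← two_mul, ← Finset.mul_sum,
      ENNReal.mul_le_mul_iff_right (by norm_num) (by norm_num), Finset.sum_add_distrib, ← Finset.mul_sum] at e3
    refine e3.trans ?_
    rw [Fin.sum_univ_castSucc, mul_add]
    exact add_le_add ih' le_rfl

end EBR


namespace EBR

/-- sign of a boolean -/
def sg (b : Bool) : ℝ := if b then 1 else -1

/-- flip one coordinate -/
def flip {n : ℕ} (i : Fin n) (e : Fin n → Bool) : Fin n → Bool := Function.update e i (!(e i))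

lemma flip_inv {n : ℕ} (i : Fin n) : Function.Involutive (flip i) := by
  intro e
  simp [flip]

lemma flip_same {n : ℕ} (i : Fin n) (e : Fin n → Bool) : sg (flip i e i) = - sg (e i) := by
  simp only [flip, Function.update_self, sg]
  cases e i <;> simp

lemma flip_ne {n : ℕ} {i j : Fin n} (h : j ≠ i) (e : Fin n → Bool) : flip i e j = e j := by
  simp [flip, Function.update_of_ne h]

/-- hybrid of two sign vectors -/
def mix {n : ℕ} (ω : (Fin n → Bool) × (Fin n → Bool)) (k : ℕ) : Fin n → Bool :=
  fun i => if (i : ℕ) < k then ω.2 i else ω.1 i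

lemma cube_bd {t w : ℝ} (ht : 1 ≤ t) {S : Type} [MeasurableSpace S] {ρ : (S → ℝ≥0∞) → ℝ≥0∞}
    (hρ : Good ρ t w) {K : ℝ≥0∞}
    (h2 : ∀ X Y : S → ℝ, Measurable X → Measurable Y →
      ρ (fun x => ‖X x + Y x‖ₑ) ^ t + ρ (fun x => ‖X x - Y x‖ₑ) ^ t ≤
      2 * (ρ (fun x => ‖X x‖ₑ) ^ t + K * ρ (fun x => ‖Y x‖ₑ) ^ t))
    {n : ℕ} (G : (Fin n → Bool) → S → ℝ) (hG : ∀ e, Measurable (G e)) {C1 : ℝ≥0∞}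
    (hC1 : ∀ z j, ρ (fun x => ‖G (Function.update z j true) x - G (Function.update z j false) x‖ₑ) ≤ C1) :
    ∑ ω : (Fin n → Bool) × (Fin n → Bool), ρ (fun x => ‖G ω.2 x - G ω.1 x‖ₑ) ^ t ≤
      2 ^ t * (2 * (K * (n * (Fintype.card ((Fin n → Bool) × (Fin n → Bool)) * C1 ^ t)))) := by
  have ht0 : 0 < t := by linarith
  let Ω := (Fin n → Bool) × (Fin n → Bool)
  let y : Fin n → Ω → S → ℝ := fun j ω x =>
    (1 / 2) * (G (Function.update (mix ω j) j true) x - G (Function.update (mix ω j) j false) x)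
  have hy : ∀ i ω, Measurable (y i ω) := fun i ω => ((hG _).sub (hG _)).const_mul _
  have hyb : ∀ i ω, ρ (fun x => ‖y i ω x‖ₑ) ≤ C1 := by
    intro i ω
    refine (hρ.mono _ _ fun x => ?_).trans (hC1 (mix ω i) i)
    simp only [y, enorm_mul]
    refine mul_le_of_le_one_left zero_le ?_
    rw [Real.enorm_eq_ofReal (by norm_num)]
    exact ENNReal.ofReal_le_one.2 (by norm_num)
  have hB : K * ∑ i, ∑ ω, ρ (fun x => ‖y i ω x‖ₑ) ^ t ≤ K * (n * (Fintype.card Ω * C1 ^ t)) := by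
    gcongr
    calc ∑ i, ∑ ω, ρ (fun x => ‖y i ω x‖ₑ) ^ t ≤ ∑ i : Fin n, ∑ ω : Ω, C1 ^ t := by
          gcongr with i _ ω _
          exact hyb i ω
      _ = _ := by simp
  have hsg : ∀ b, sg b = 1 ∨ sg b = -1 := fun b => by cases b <;> simp [sg]
  let N : Ω → S → ℝ := fun ω x => ∑ i, sg (ω.2 i) * y i ω x
  let M : Ω → S → ℝ := fun ω x => ∑ i, sg (ω.1 i) * y i ω x
  have hNb : ∑ ω, ρ (fun x => ‖N ω x‖ₑ) ^ t ≤ K * (n * (Fintype.card Ω * C1 ^ t)) := by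
    refine (mart ht0 hρ h2 n (fun i ω => (ω.1, flip i ω.2)) (fun i ω => ?_) (fun i ω => sg (ω.2 i)) y hy
      (fun i ω => hsg _) (fun i ω => flip_same i _) (fun i j ω hji => ?_) (fun i j ω hji => ?_)).trans hB
    · simp [flip_inv i ω.2]
    · simp only [flip_ne hji.ne]
    · have : mix (ω.1, flip i ω.2) j = mix ω j := by
        funext k
        simp only [mix]
        split_ifs with hk
        · rw [flip_ne]
          rintro rfl
          exact absurd (Fin.lt_def.2 hk) (not_lt.2 hji)
        · rfl
      simp only [y, this]
  have hMb : ∑ ω, ρ (fun x => ‖M ω x‖ₑ) ^ t ≤ K * (n * (Fintype.card Ω * C1 ^ t)) := by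
    have hM : ∀ ω x, M ω x = ∑ i : Fin n, sg (ω.1 i.rev) * y i.rev ω x := fun ω x =>
      (Equiv.sum_comp Fin.revPerm fun i => sg (ω.1 i) * y i ω x).symm
    have hB' : K * ∑ i : Fin n, ∑ ω, ρ (fun x => ‖y i.rev ω x‖ₑ) ^ t ≤ K * (n * (Fintype.card Ω * C1 ^ t)) := by
      refine le_trans (le_of_eq ?_) hB
      congr 1
      exact Equiv.sum_comp Fin.revPerm fun i => ∑ ω, ρ (fun x => ‖y i ω x‖ₑ) ^ t
    simp only [hM]
    refine (mart ht0 hρ h2 n (fun i ω => (flip i.rev ω.1, ω.2)) (fun i ω => ?_) (fun i ω => sg (ω.1 i.rev))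
      (fun i => y i.rev) (fun i => hy _)
      (fun i ω => hsg _) (fun i ω => flip_same _ _) (fun i j ω hji => ?_) (fun i j ω hji => ?_)).trans hB'
    · simp [flip_inv i.rev ω.1]
    · show sg (flip i.rev ω.1 j.rev) = _
      rw [flip_ne]
      intro h
      exact hji.ne (Fin.rev_injective h)
    · have : ∀ b, Function.update (mix (flip i.rev ω.1, ω.2) j.rev) j.rev b =
          Function.update (mix ω j.rev) j.rev b := by
        intro b
        funext k
        by_cases hk : k = j.rev
        · subst hk; simp
        · rw [Function.update_of_ne hk, Function.update_of_ne hk]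
          simp only [mix]
          split_ifs with h
          · rfl
          · rw [flip_ne]
            rintro rfl
            have h5 : i.rev ≤ j.rev := Fin.rev_le_rev.2 hji
            have h6 : j.rev ≤ i.rev := not_lt.1 h
            exact hk (le_antisymm h5 h6)
      simp only [y, this]
  have key : ∀ ω : Ω, ∀ x, G ω.2 x - G ω.1 x = N ω x - M ω x := by
    intro ω x
    have a1 := fin_tele n fun k => G (mix ω k) x
    have a2 : mix ω (Fin.last n : Fin (n + 1)) = ω.2 := by
      funext i; simp [mix]
    have a3 : mix ω ((0 : Fin (n + 1)) : ℕ) = ω.1 := by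
      funext i; simp [mix]
    rw [a2, a3] at a1
    rw [← a1]
    simp only [N, M]
    rw [← Finset.sum_sub_distrib]
    refine Finset.sum_congr rfl fun j _ => ?_
    have b1 : mix ω (j.succ : Fin (n + 1)) = Function.update (mix ω j) j (ω.2 j) := by
      funext i
      by_cases hi : i = j
      · subst hi; simp [mix]
      · rw [Function.update_of_ne hi]
        have : (i : ℕ) ≠ j := fun h => hi (Fin.ext h)
        have : (i : ℕ) < j + 1 ↔ (i : ℕ) < j := by omega
        simp [mix, this]
    have b2 : mix ω (j.castSucc : Fin (n + 1)) = Function.update (mix ω j) j (ω.1 j) := by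
      funext i
      by_cases hi : i = j
      · subst hi; simp [mix]
      · rw [Function.update_of_ne hi]; simp [mix]
    rw [b1, b2]
    simp only [y]
    cases ω.2 j <;> cases ω.1 j <;> simp [sg] <;> ring
  have hNm : ∀ ω, Measurable (N ω) := fun ω =>
    Finset.measurable_fun_sum _ fun i _ => (hy _ _).const_mul _
  have hMm : ∀ ω, Measurable (M ω) := fun ω =>
    Finset.measurable_fun_sum _ fun i _ => (hy _ _).const_mul _
  have hone : ∀ ω : Ω, ρ (fun x => ‖G ω.2 x - G ω.1 x‖ₑ) ^ t ≤
      2 ^ t * (ρ (fun x => ‖N ω x‖ₑ) ^ t + ρ (fun x => ‖M ω x‖ₑ) ^ t) := by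
    intro ω
    simp only [key]
    refine (ENNReal.rpow_le_rpow (hρ.tri2 ht (hNm ω) (hMm ω)) ht0.le).trans ?_
    refine (ENNReal.rpow_add_le_mul_rpow_add_rpow _ _ ht).trans ?_
    gcongr
    · norm_num
    · linarith
  calc _ ≤ ∑ ω : Ω, 2 ^ t * (ρ (fun x => ‖N ω x‖ₑ) ^ t + ρ (fun x => ‖M ω x‖ₑ) ^ t) :=
        Finset.sum_le_sum fun ω _ => hone ω
    _ = 2 ^ t * (∑ ω : Ω, ρ (fun x => ‖N ω x‖ₑ) ^ t + ∑ ω : Ω, ρ (fun x => ‖M ω x‖ₑ) ^ t) := by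
        rw [← Finset.mul_sum, Finset.sum_add_distrib]
    _ ≤ _ := by
        rw [two_mul (K * _)]
        gcongr

/-- Hamming distance -/
def ham {n : ℕ} (ω : (Fin n → Bool) × (Fin n → Bool)) : ℝ := ∑ i, if ω.1 i = ω.2 i then (0 : ℝ) else 1

lemma ham_nonneg {n : ℕ} (ω : (Fin n → Bool) × (Fin n → Bool)) : 0 ≤ ham ω :=
  Finset.sum_nonneg fun i _ => by split_ifs <;> norm_num

lemma ham_sum {n : ℕ} {δ : ℝ} (hδ : 0 ≤ δ) :
    (Fintype.card ((Fin n → Bool) × (Fin n → Bool)) : ℝ) * ((n / 2 : ℝ) ^ δ) ≤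
      2 * ∑ ω : (Fin n → Bool) × (Fin n → Bool), ham ω ^ δ := by
  let T : (Fin n → Bool) × (Fin n → Bool) → (Fin n → Bool) × (Fin n → Bool) :=
    fun ω => (ω.1, fun i => !(ω.2 i))
  have hT : Function.Involutive T := fun ω => by simp [T]
  have h1 : ∀ ω, ham ω + ham (T ω) = n := by
    intro ω
    simp only [ham, ← Finset.sum_add_distrib]
    rw [Finset.sum_congr rfl (g := fun _ => (1 : ℝ))]
    · simp
    · intro i _
      simp only [T]
      have hb : ∀ a b : Bool, ((if a = b then (0 : ℝ) else 1) + if a = !b then 0 else 1) = 1 := by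
        intro a b
        cases a <;> cases b <;> simp
      exact hb _ _
  have h2 : ∀ ω, (n / 2 : ℝ) ^ δ ≤ ham ω ^ δ + ham (T ω) ^ δ := by
    intro ω
    have a1 := h1 ω
    have a2 := ham_nonneg ω
    have a3 := ham_nonneg (T ω)
    have b2 : 0 ≤ ham ω ^ δ := by positivity
    have b3 : 0 ≤ ham (T ω) ^ δ := by positivity
    rcases le_total (n / 2 : ℝ) (ham ω) with h | h
    · have := Real.rpow_le_rpow (by positivity) h hδ
      linarith
    · have := Real.rpow_le_rpow (by positivity) (show (n / 2 : ℝ) ≤ ham (T ω) by linarith) hδ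
      linarith
  have h3 := Finset.sum_le_sum fun ω (_ : ω ∈ Finset.univ) => h2 ω
  rw [Finset.sum_add_distrib, show ∑ ω, ham (T ω) ^ δ = ∑ ω, ham ω ^ δ from
    Equiv.sum_comp hT.toPerm fun ω => ham ω ^ δ] at h3
  simp only [Finset.sum_const, nsmul_eq_mul, Finset.card_univ] at h3
  linarith

lemma cube_concl {t w γ C : ℝ} (ht : 1 ≤ t) (ht2 : t ≤ 2) (hw : 2 ≤ w) (hγ : 0 ≤ γ) (hC : 0 < C)
    (H : ∀ n : ℕ, ∃ (S : Type) (_ : MeasurableSpace S) (ρ : (S → ℝ≥0∞) → ℝ≥0∞)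
      (G : (Fin n → Bool) → S → ℝ), Good ρ t w ∧ (∀ a, Measurable (G a)) ∧
      (∀ z j, ρ (fun x => ‖G (Function.update z j true) x - G (Function.update z j false) x‖ₑ) ≤
        ENNReal.ofReal C) ∧
      ∀ ω : (Fin n → Bool) × (Fin n → Bool), ENNReal.ofReal (ham ω ^ γ) ≤
        ENNReal.ofReal C * ρ (fun x => ‖G ω.2 x - G ω.1 x‖ₑ)) : t * γ ≤ 1 := by
  have ht0 : 0 < t := by linarith
  obtain ⟨K, hK, h2⟩ := two_pt t w ht ht2 hw
  refine growth (K := 2 ^ (γ * t) * (2 * (C ^ t * (2 ^ t * (2 * (K.toReal * C ^ t)))))) fun n hn => ?_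
  rw [Real.rpow_one]
  obtain ⟨S, _, ρ, G, hρ, hG, hb1, hb2⟩ := H n
  have h3 := cube_bd ht hρ (h2 S ρ hρ) G hG hb1
  set cd := Fintype.card ((Fin n → Bool) × (Fin n → Bool)) with hcd
  have hcd0 : (0 : ℝ) < cd := by
    have : 0 < cd := Fintype.card_pos
    exact_mod_cast this
  have h4 : ENNReal.ofReal (∑ ω : (Fin n → Bool) × (Fin n → Bool), ham ω ^ (γ * t)) ≤
      ENNReal.ofReal (C ^ t * (2 ^ t * (2 * (K.toReal * (n * (cd * C ^ t)))))) := by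
    calc _ = ∑ ω : (Fin n → Bool) × (Fin n → Bool), ENNReal.ofReal (ham ω ^ γ) ^ t := by
          rw [ENNReal.ofReal_sum_of_nonneg (fun ω _ => Real.rpow_nonneg (ham_nonneg ω) _)]
          refine Finset.sum_congr rfl fun ω _ => ?_
          rw [ENNReal.ofReal_rpow_of_nonneg (Real.rpow_nonneg (ham_nonneg ω) _) ht0.le,
            ← Real.rpow_mul (ham_nonneg ω)]
      _ ≤ ∑ ω : (Fin n → Bool) × (Fin n → Bool),
          ENNReal.ofReal C ^ t * ρ (fun x => ‖G ω.2 x - G ω.1 x‖ₑ) ^ t := by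
          refine Finset.sum_le_sum fun ω _ => ?_
          rw [← ENNReal.mul_rpow_of_nonneg _ _ ht0.le]
          exact ENNReal.rpow_le_rpow (hb2 ω) ht0.le
      _ = ENNReal.ofReal C ^ t * ∑ ω : (Fin n → Bool) × (Fin n → Bool),
          ρ (fun x => ‖G ω.2 x - G ω.1 x‖ₑ) ^ t := by rw [Finset.mul_sum]
      _ ≤ ENNReal.ofReal C ^ t * (2 ^ t * (2 * (K * (n * (cd * ENNReal.ofReal C ^ t))))) := by gcongr
      _ = _ := by
          have e2 : (2 : ℝ≥0∞) ^ t = ENNReal.ofReal (2 ^ t) := by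
            rw [← ENNReal.ofReal_rpow_of_nonneg (by norm_num) ht0.le]; simp
          have e3 : (2 : ℝ≥0∞) = ENNReal.ofReal 2 := by simp
          have e4 : (n : ℝ≥0∞) = ENNReal.ofReal n := by simp
          have e5 : (cd : ℝ≥0∞) = ENNReal.ofReal cd := by simp
          rw [e2, e3, e4, e5, ENNReal.ofReal_rpow_of_nonneg hC.le ht0.le]
          nth_rewrite 1 [← ENNReal.ofReal_toReal hK]
          have := K.toReal_nonneg
          rw [ENNReal.ofReal_mul (by positivity), ENNReal.ofReal_mul (by positivity),
            ENNReal.ofReal_mul (by positivity), ENNReal.ofReal_mul (by positivity),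
            ENNReal.ofReal_mul (by positivity), ENNReal.ofReal_mul (by positivity)]
  have := K.toReal_nonneg
  rw [ENNReal.ofReal_le_ofReal_iff (by positivity)] at h4
  have h5 := ham_sum (n := n) (δ := γ * t) (by positivity)
  have h6 : (cd : ℝ) * (n / 2 : ℝ) ^ (γ * t) ≤
      cd * ((2 * (C ^ t * (2 ^ t * (2 * (K.toReal * C ^ t))))) * n) := by
    refine h5.trans ?_
    calc _ ≤ 2 * (C ^ t * (2 ^ t * (2 * (K.toReal * (n * (cd * C ^ t)))))) := by gcongr
      _ = _ := by ring
  have h7 := le_of_mul_le_mul_left h6 hcd0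
  rw [Real.div_rpow (by positivity) (by norm_num), div_le_iff₀ (by positivity)] at h7
  rw [mul_comm t γ]
  linarith

end EBR


namespace EBR

lemma ham_pos {n : ℕ} {a b : Fin n → Bool} (h : a ≠ b) : 0 < ham (a, b) := by
  obtain ⟨i, hi⟩ := Function.ne_iff.1 h
  refine Finset.sum_pos' (fun i _ => by split_ifs <;> norm_num) ⟨i, Finset.mem_univ _, ?_⟩
  simp [hi]

lemma ham_symm {n : ℕ} (a b : Fin n → Bool) : ham (a, b) = ham (b, a) := by
  simp only [ham, eq_comm]

lemma cube_mdl {r α t w κ : ℝ} (hr : 0 < r) (hα : 0 < α) (hκ : 0 < κ) (ht : 1 ≤ t) (ht2 : t ≤ 2)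
    (hw : 2 ≤ w) (H : Mdl r α t w) (ι : ℕ → Type) [∀ k, Fintype (ι k)] [∀ k, Nonempty (ι k)]
    (v : ∀ n : ℕ, (Fin n → Bool) → ι n → ℝ)
    (h1 : ∀ n z j, ∑ i, |v n (Function.update z j true) i - v n (Function.update z j false) i| ^ r ≤ 2 ^ r)
    (h2 : ∀ n a b, ham (a, b) ^ (r / κ) ≤ ∑ i, |v n a i - v n b i| ^ r) : t * α ≤ κ := by
  obtain ⟨C, hC, hM⟩ := H (fun n => Fin n → Bool) ι v (fun n a b hab => by
    by_contra hne
    have h3 := h2 n a b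
    rw [hab] at h3
    have h4 := Real.rpow_pos_of_pos (ham_pos hne) (r / κ)
    simp [Real.zero_rpow hr.ne'] at h3
    linarith)
  have key : t * (α / κ) ≤ 1 := by
    refine cube_concl (C := C * 2 ^ α + C) ht ht2 hw (by positivity) (by positivity) fun n => ?_
    obtain ⟨S, mS, ρ, G, hρ, hG, hb⟩ := hM n
    refine ⟨S, mS, ρ, G, hρ, hG, fun z j => ?_, fun ω => ?_⟩
    · refine (hb _ _).1.trans (ENNReal.ofReal_le_ofReal ?_)
      calc _ ≤ C * ((2 : ℝ) ^ r) ^ (α / r) := by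
            gcongr
            exact h1 n z j
        _ = C * 2 ^ α := by
            rw [← Real.rpow_mul (by norm_num), mul_div_cancel₀ _ hr.ne']
        _ ≤ _ := by linarith
    · refine le_trans (ENNReal.ofReal_le_ofReal ?_) ((hb _ _).2.trans (mul_le_mul_left (ENNReal.ofReal_le_ofReal ?_) _))
      · calc ham ω ^ (α / κ) = (ham ω ^ (r / κ)) ^ (α / r) := by
              rw [← Real.rpow_mul (ham_nonneg ω)]; congr 1; field_simp
          _ ≤ _ := by
              have h3 := ham_nonneg ω
              have h4 := h2 n ω.2 ω.1
              rw [ham_symm] at h4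
              gcongr
      · have : 0 < C * 2 ^ α := by positivity
        linarith
  rw [← mul_div_assoc, div_le_one hκ] at key
  exact key

lemma sg_sub (a b : Bool) : |sg a - sg b| = if a = b then 0 else 2 := by
  cases a <;> cases b <;> simp [sg] <;> norm_num

theorem T2a {r α t w : ℝ} (hr : 1 ≤ r) (hα : 0 < α) (ht : 1 ≤ t) (ht2 : t ≤ 2)
    (hw : 2 ≤ w) (H : Mdl r α t w) : t * α ≤ r := by
  have hr0 : 0 < r := by linarith
  have key : ∀ n (a b : Fin n → Bool), ∑ i : Option (Fin n),
      |(match i with | none => (0 : ℝ) | some j => sg (a j)) -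
        (match i with | none => (0 : ℝ) | some j => sg (b j))| ^ r = 2 ^ r * ham (a, b) := by
    intro n a b
    rw [Fintype.sum_option, ham, Finset.mul_sum]
    simp only [sub_self, abs_zero, Real.zero_rpow hr0.ne', zero_add]
    refine Finset.sum_congr rfl fun i _ => ?_
    rw [sg_sub]
    split_ifs <;> simp [hr0.ne']
  refine cube_mdl hr0 hα hr0 ht ht2 hw H (fun n => Option (Fin n))
    (fun n a i => match i with | none => (0 : ℝ) | some j => sg (a j)) (fun n z j => ?_) (fun n a b => ?_)
  · rw [key]
    have : ham (Function.update z j true, Function.update z j false) = 1 := by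
      rw [ham, Finset.sum_eq_single j]
      · simp
      · intro i _ hi; simp [Function.update_of_ne hi]
      · simp
    rw [this, mul_one]
  · rw [key, div_self hr0.ne', Real.rpow_one]
    have : (1 : ℝ) ≤ 2 ^ r := Real.one_le_rpow (by norm_num) hr0.le
    nlinarith [ham_nonneg (a, b)]

lemma sg_orth {n : ℕ} (i j : Fin n) : ∑ e : Fin n → Bool, sg (e i) * sg (e j) = if i = j then 2 ^ n else 0 := by
  split_ifs with h
  · subst h
    have : ∀ b, sg b * sg b = 1 := fun b => by cases b <;> simp [sg]
    simp [this]
  · have h1 : ∑ e : Fin n → Bool, sg (flip i e i) * sg (flip i e j) = ∑ e : Fin n → Bool, sg (e i) * sg (e j) :=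
      Equiv.sum_comp (flip_inv i).toPerm fun e => sg (e i) * sg (e j)
    simp only [flip_same, flip_ne (Ne.symm h), neg_mul, Finset.sum_neg_distrib] at h1
    linarith

lemma sg_l2 {n : ℕ} (d : Fin n → ℝ) : ∑ e : Fin n → Bool, (∑ i, d i * sg (e i)) ^ 2 = 2 ^ n * ∑ i, d i ^ 2 := by
  have : ∀ e : Fin n → Bool, (∑ i, d i * sg (e i)) ^ 2 = ∑ i, ∑ j, d i * d j * (sg (e i) * sg (e j)) := by
    intro e
    rw [sq, Finset.sum_mul_sum]
    refine Finset.sum_congr rfl fun i _ => Finset.sum_congr rfl fun j _ => by ring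
  simp only [this]
  rw [Finset.sum_comm, Finset.mul_sum]
  refine Finset.sum_congr rfl fun i _ => ?_
  rw [Finset.sum_comm]
  simp only [← Finset.mul_sum, sg_orth]
  simp
  ring

theorem T2b {r α t w : ℝ} (hr : 2 ≤ r) (hα : 0 < α) (ht : 1 ≤ t) (ht2 : t ≤ 2)
    (hw : 2 ≤ w) (H : Mdl r α t w) : t * α ≤ 2 := by
  have hr0 : 0 < r := by linarith
  have key : ∀ n (a b : Fin n → Bool), ∑ e : Fin n → Bool,
      |((2 : ℝ) ^ n)⁻¹ ^ (1 / r) * ∑ i, sg (a i) * sg (e i) - ((2 : ℝ) ^ n)⁻¹ ^ (1 / r) * ∑ i, sg (b i) * sg (e i)| ^ r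
      = ∑ e : Fin n → Bool, ((2 : ℝ) ^ n)⁻¹ * |∑ i, (sg (a i) - sg (b i)) * sg (e i)| ^ r := by
    intro n a b
    refine Finset.sum_congr rfl fun e _ => ?_
    rw [← mul_sub, ← Finset.sum_sub_distrib, abs_mul, Real.mul_rpow (abs_nonneg _) (abs_nonneg _),
      abs_of_nonneg (by positivity), ← Real.rpow_mul (by positivity), one_div_mul_cancel hr0.ne', Real.rpow_one]
    simp only [sub_mul]
  refine cube_mdl hr0 hα (by norm_num) ht ht2 hw H (fun n => Fin n → Bool)
    (fun n a e => ((2 : ℝ) ^ n)⁻¹ ^ (1 / r) * ∑ i, sg (a i) * sg (e i)) (fun n z j => ?_) (fun n a b => ?_)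
  · rw [key]
    have : ∀ e : Fin n → Bool, |∑ i, (sg (Function.update z j true i) - sg (Function.update z j false i)) * sg (e i)| = 2 := by
      intro e
      rw [Finset.sum_eq_single j]
      · simp only [Function.update_self]
        cases e j <;> simp [sg] <;> norm_num
      · intro i _ hi; simp [Function.update_of_ne hi]
      · simp
    simp [this]
  · rw [key]
    have h1 := Real.rpow_arith_mean_le_arith_mean_rpow (Finset.univ : Finset (Fin n → Bool))
      (fun _ => ((2 : ℝ) ^ n)⁻¹) (fun e => (∑ i, (sg (a i) - sg (b i)) * sg (e i)) ^ 2)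
      (fun _ _ => by positivity) (by simp) (fun _ _ => by positivity) (show 1 ≤ r / 2 by linarith)
    rw [← Finset.mul_sum, sg_l2, ← mul_assoc, inv_mul_cancel₀ (by positivity), one_mul] at h1
    have h2 : ∑ i, (sg (a i) - sg (b i)) ^ 2 = 4 * ham (a, b) := by
      rw [ham, Finset.mul_sum]
      refine Finset.sum_congr rfl fun i _ => ?_
      rw [← sq_abs, sg_sub]
      split_ifs <;> norm_num
    rw [h2] at h1
    have h3 := ham_nonneg (a, b)
    calc ham (a, b) ^ (r / 2) ≤ (4 * ham (a, b)) ^ (r / 2) := by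
          gcongr; linarith
      _ ≤ _ := h1
      _ = _ := by
          refine Finset.sum_congr rfl fun e _ => ?_
          rw [← sq_abs, ← Real.rpow_natCast _ 2, ← Real.rpow_mul (abs_nonneg _)]
          congr 2
          push_cast
          ring

end EBR


namespace EBR

lemma rpow_le_exp {w : ℝ} (hw : 0 ≤ w) : ∃ C : ℝ, 0 < C ∧ ∀ x : ℝ, |x| ^ w ≤ C * (Real.exp x + Real.exp (-x)) := by
  obtain ⟨m, hm⟩ := exists_nat_ge w
  refine ⟨1 + m.factorial, by positivity, fun x => ?_⟩
  have h1 : |x| ^ w ≤ 1 + |x| ^ m := by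
    rcases le_total |x| 1 with h | h
    · have := Real.rpow_le_one (abs_nonneg x) h hw
      have : 0 ≤ |x| ^ m := by positivity
      linarith
    · have := Real.rpow_le_rpow_of_exponent_le h hm
      rw [Real.rpow_natCast] at this
      linarith
  have h2 := Real.pow_div_factorial_le_exp |x| (abs_nonneg _) m
  rw [div_le_iff₀ (by positivity)] at h2
  have h3 : 1 ≤ Real.exp |x| := Real.one_le_exp (abs_nonneg _)
  have h4 : Real.exp |x| ≤ Real.exp x + Real.exp (-x) := by
    rcases abs_choice x with h | h <;> rw [h]
    · linarith [Real.exp_pos (-x)]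
    · linarith [Real.exp_pos x]
  have h5 : (0 : ℝ) < m.factorial := by positivity
  calc |x| ^ w ≤ (1 + m.factorial) * Real.exp |x| := by nlinarith
    _ ≤ _ := by gcongr

lemma sum_exp {n : ℕ} (a : Fin n → ℝ) (ha : ∑ i, a i ^ 2 ≤ 1) :
    ∑ e : Fin n → Bool, Real.exp (∑ i, a i * sg (e i)) ≤ 2 ^ n * Real.exp (1 / 2) := by
  have h1 : ∑ e : Fin n → Bool, Real.exp (∑ i, a i * sg (e i)) = ∏ i, ∑ b : Bool, Real.exp (a i * sg b) := by
    rw [Finset.prod_univ_sum, Fintype.piFinset_univ]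
    exact Finset.sum_congr rfl fun e _ => Real.exp_sum _ _
  rw [h1]
  calc _ ≤ ∏ i : Fin n, (2 * Real.exp (a i ^ 2 / 2)) := by
        refine Finset.prod_le_prod (fun i _ => Finset.sum_nonneg fun b _ => (Real.exp_pos _).le) fun i _ => ?_
        have := Real.cosh_le_exp_half_sq (a i)
        rw [Real.cosh_eq] at this
        simp only [Fintype.sum_bool, sg]
        simp
        linarith
    _ = 2 ^ n * Real.exp (∑ i, a i ^ 2 / 2) := by
        rw [Finset.prod_mul_distrib, Real.exp_sum]; simp
    _ ≤ _ := by
        gcongr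
        rw [← Finset.sum_div]; linarith

lemma khin {u : ℝ} (hu : 1 < u) : ∃ K : ℝ, 0 < K ∧ ∀ (n : ℕ) (g : (Fin n → Bool) → ℝ),
    (∑ j, (((2 : ℝ) ^ n)⁻¹ * ∑ e, sg (e j) * g e) ^ 2) ^ (1 / 2 : ℝ) ≤
      K * (((2 : ℝ) ^ n)⁻¹ * ∑ e, |g e| ^ u) ^ (1 / u) := by
  have hu0 : 0 < u := by linarith
  have hpq : u.HolderConjugate (Real.conjExponent u) := Real.HolderConjugate.conjExponent hu
  set u' := Real.conjExponent u with hu'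
  have hu'0 : 0 < u' := hpq.symm.pos
  obtain ⟨C, hC, hexp⟩ := rpow_le_exp hu'0.le
  refine ⟨(C * (2 * Real.exp (1 / 2))) ^ (1 / u'), by positivity, fun n g => ?_⟩
  set V : Fin n → ℝ := fun j => ((2 : ℝ) ^ n)⁻¹ * ∑ e, sg (e j) * g e with hV
  set Q := ∑ j, V j ^ 2 with hQ
  have hQ0 : 0 ≤ Q := Finset.sum_nonneg fun _ _ => by positivity
  rw [← Real.sqrt_eq_rpow]
  have hg0 : 0 ≤ ∑ e, |g e| ^ u := Finset.sum_nonneg fun _ _ => by positivity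
  rcases hQ0.eq_or_lt with h0 | h0
  · rw [← h0, Real.sqrt_zero]; positivity
  have hs : 0 < √Q := Real.sqrt_pos.2 h0
  have hss : √Q * √Q = Q := Real.mul_self_sqrt hQ0
  set a : Fin n → ℝ := fun j => V j / √Q with ha
  have ha2 : ∑ i, a i ^ 2 = 1 := by
    simp only [ha, div_pow]
    rw [← Finset.sum_div, ← hQ, sq, hss, div_self h0.ne']
  set X : (Fin n → Bool) → ℝ := fun e => ∑ i, a i * sg (e i) with hX
  have e1 : √Q = ((2 : ℝ) ^ n)⁻¹ * ∑ e, g e * X e := by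
    have : √Q = ∑ j, a j * V j := by
      have : ∀ j, a j * V j = V j ^ 2 / √Q := fun j => by simp only [ha]; ring
      simp only [this]
      rw [← Finset.sum_div, ← hQ, eq_div_iff hs.ne', hss]
    rw [this]
    simp only [hV, hX, Finset.mul_sum]
    rw [Finset.sum_comm]
    refine Finset.sum_congr rfl fun e _ => Finset.sum_congr rfl fun j _ => by ring
  have hX1 : ((2 : ℝ) ^ n)⁻¹ * ∑ e, |X e| ^ u' ≤ C * (2 * Real.exp (1 / 2)) := by
    have f1 := sum_exp a ha2.le
    have f2 := sum_exp (fun i => - a i) (by simpa using ha2.le)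
    simp only [neg_mul, Finset.sum_neg_distrib] at f2
    rw [inv_mul_le_iff₀ (by positivity)]
    calc _ ≤ ∑ e, C * (Real.exp (X e) + Real.exp (- X e)) := Finset.sum_le_sum fun e _ => hexp _
      _ = C * (∑ e, Real.exp (X e) + ∑ e, Real.exp (- X e)) := by
          rw [← Finset.mul_sum, Finset.sum_add_distrib]
      _ ≤ C * (2 ^ n * Real.exp (1 / 2) + 2 ^ n * Real.exp (1 / 2)) := by gcongr
      _ = _ := by ring
  have hX0 : 0 ≤ ∑ e, |X e| ^ u' := Finset.sum_nonneg fun _ _ => by positivity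
  have e2 := Real.inner_le_Lp_mul_Lq Finset.univ g X hpq
  calc √Q = ((2 : ℝ) ^ n)⁻¹ * ∑ e, g e * X e := e1
    _ ≤ ((2 : ℝ) ^ n)⁻¹ * ((∑ e, |g e| ^ u) ^ (1 / u) * (∑ e, |X e| ^ u') ^ (1 / u')) := by gcongr
    _ = (((2 : ℝ) ^ n)⁻¹ * ∑ e, |X e| ^ u') ^ (1 / u') * (((2 : ℝ) ^ n)⁻¹ * ∑ e, |g e| ^ u) ^ (1 / u) := by
        rw [Real.mul_rpow (by positivity) hX0, Real.mul_rpow (by positivity) hg0]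
        have : ((2 : ℝ) ^ n)⁻¹ = ((2 : ℝ) ^ n)⁻¹ ^ (1 / u') * ((2 : ℝ) ^ n)⁻¹ ^ (1 / u) := by
          rw [← Real.rpow_add (by positivity)]
          have := hpq.symm.inv_add_inv_eq_one
          rw [one_div, one_div, this, Real.rpow_one]
        nth_rewrite 1 [this]
        ring
    _ ≤ _ := by gcongr

lemma lcc {n : ℕ} (V : Fin n → ℝ) {cc : ℝ} (hcc : 2 ≤ cc) :
    (∑ j, |V j| ^ cc) ^ (1 / cc) ≤ (∑ j, V j ^ 2) ^ (1 / 2 : ℝ) := by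
  have hc0 : 0 < cc := by linarith
  set Q := ∑ j, V j ^ 2 with hQ
  have hQ0 : 0 ≤ Q := Finset.sum_nonneg fun _ _ => by positivity
  have hj : ∀ j, |V j| ≤ Q ^ (1 / 2 : ℝ) := fun j => by
    rw [← Real.sqrt_eq_rpow]
    refine Real.abs_le_sqrt ?_
    exact Finset.single_le_sum (f := fun j => V j ^ 2) (fun _ _ => by positivity) (Finset.mem_univ j)
  have hV0 : 0 ≤ ∑ j, |V j| ^ cc := Finset.sum_nonneg fun _ _ => by positivity
  rw [one_div, Real.rpow_inv_le_iff_of_pos hV0 (by positivity) hc0]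
  rcases hQ0.eq_or_lt with h0 | h0
  · have : ∀ j, |V j| ^ cc = 0 := fun j => by
      have := hj j
      rw [← h0, Real.zero_rpow (by norm_num)] at this
      rw [le_antisymm this (abs_nonneg _), Real.zero_rpow hc0.ne']
    rw [Finset.sum_congr rfl fun j _ => this j]
    simp; positivity
  calc ∑ j, |V j| ^ cc ≤ ∑ j, (Q ^ (1 / 2 : ℝ)) ^ (cc - 2) * V j ^ 2 := by
        refine Finset.sum_le_sum fun j _ => ?_
        rcases (abs_nonneg (V j)).eq_or_lt with h | h
        · rw [← h, Real.zero_rpow hc0.ne']; positivity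
        · calc |V j| ^ cc = |V j| ^ (cc - 2) * V j ^ 2 := by
                rw [← sq_abs, ← Real.rpow_natCast _ 2, ← Real.rpow_add h]; congr 1; push_cast; ring
            _ ≤ _ := by
                gcongr
                exact hj j
    _ = (Q ^ (1 / 2 : ℝ)) ^ cc := by
        rw [← Finset.mul_sum, ← hQ, Real.rpow_sub (by positivity), ← Real.rpow_mul hQ0, ← Real.rpow_mul hQ0]
        norm_num
        field_simp

end EBR


namespace EBR

lemma khin2 {u cc : ℝ} (hu : 1 < u) (hcc : 2 ≤ cc) : ∃ K : ℝ≥0, ∀ (n : ℕ) (g : (Fin n → Bool) → ℝ),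
    (∑ j, ‖((2 : ℝ) ^ n)⁻¹ * ∑ e, sg (e j) * g e‖ₑ ^ cc) ^ (1 / cc) ≤
      K * (∑ e, ENNReal.ofReal (((2 : ℝ) ^ n)⁻¹) * ‖g e‖ₑ ^ u) ^ (1 / u) := by
  have hc0 : 0 < cc := by linarith
  have hu0 : 0 < u := by linarith
  obtain ⟨K, hK, h⟩ := khin hu
  refine ⟨K.toNNReal, fun n g => ?_⟩
  have h1 := (lcc (fun j => ((2 : ℝ) ^ n)⁻¹ * ∑ e, sg (e j) * g e) hcc).trans (h n g)
  simp only [enorm_rpow' _ hc0.le, enorm_rpow' _ hu0.le]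
  rw [← ENNReal.ofReal_sum_of_nonneg (fun _ _ => by positivity), ← Finset.mul_sum,
    ← ENNReal.ofReal_sum_of_nonneg (fun _ _ => by positivity), ← ENNReal.ofReal_mul (by positivity),
    ENNReal.ofReal_rpow_of_nonneg (Finset.sum_nonneg fun _ _ => by positivity) (by positivity),
    ENNReal.ofReal_rpow_of_nonneg (mul_nonneg (by positivity) (Finset.sum_nonneg fun _ _ => by positivity)) (by positivity)]
  change _ ≤ ENNReal.ofReal K * _
  rw [← ENNReal.ofReal_mul hK.le]
  exact ENNReal.ofReal_le_ofReal h1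

lemma diff_sum {n : ℕ} (F : (Fin n → Bool) → ℝ) (j : Fin n) (c0 : ℝ) :
    ∑ d : Fin n → Bool, (F (Function.update d j true) - F (Function.update d j false)) =
      ∑ d : Fin n → Bool, sg (d j) * (2 * (F d - c0)) := by
  have h1 : ∀ d : Fin n → Bool, F (Function.update d j true) - F (Function.update d j false) =
      sg (d j) * F d - sg (d j) * F (flip j d) := by
    intro d
    have h2 : Function.update d j (d j) = d := Function.update_eq_self j d
    simp only [flip]
    cases h : d j <;> rw [h] at h2 <;> simp [sg, h2]
    ring
  have h3 : ∑ d : Fin n → Bool, sg (flip j d j) * F (flip j d) = ∑ d : Fin n → Bool, sg (d j) * F d :=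
    Equiv.sum_comp (flip_inv j).toPerm fun d => sg (d j) * F d
  have h4 : ∑ d : Fin n → Bool, sg (flip j d j) = ∑ d : Fin n → Bool, sg (d j) :=
    Equiv.sum_comp (flip_inv j).toPerm fun d => sg (d j)
  simp only [flip_same, neg_mul, Finset.sum_neg_distrib] at h3 h4
  have h5 : ∀ d : Fin n → Bool, sg (d j) * (2 * (F d - c0)) = 2 * (sg (d j) * F d) - 2 * c0 * sg (d j) :=
    fun d => by ring
  simp only [h1, h5, Finset.sum_sub_distrib, ← Finset.mul_sum]
  have h6 : ∑ d : Fin n → Bool, sg (d j) = 0 := by linarith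
  rw [h6]
  linarith

/-- corner of the unit cube at `x` -/
def pt {n m : ℕ} (x : Fin n → Fin m) (d : Fin n → Bool) : Fin n → Fin (m + 1) :=
  fun i => if d i then (x i).succ else (x i).castSucc

lemma pt_true {n m : ℕ} (x : Fin n → Fin m) (d : Fin n → Bool) (j : Fin n) :
    pt x (Function.update d j true) = Function.update (pt x d) j (x j).succ := by
  funext i
  by_cases h : i = j
  · subst h; simp [pt]
  · simp [pt, Function.update_of_ne h]

lemma pt_false {n m : ℕ} (x : Fin n → Fin m) (d : Fin n → Bool) (j : Fin n) :
    pt x (Function.update d j false) = Function.update (pt x d) j (x j).castSucc := by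
  funext i
  by_cases h : i = j
  · subst h; simp [pt]
  · simp [pt, Function.update_of_ne h]

lemma pt_upd {n m : ℕ} (x : Fin n → Fin m) (d : Fin n → Bool) (j : Fin n) (k : Fin m) (b : Fin (m + 1)) :
    Function.update (pt (Function.update x j k) d) j b = Function.update (pt x d) j b := by
  funext i
  by_cases h : i = j
  · subst h; simp
  · simp [pt, Function.update_of_ne h]

/-- averaged increments -/
def Vf {n m : ℕ} {S : Type} (G : (Fin n → Fin (m + 1)) → S → ℝ) (j : Fin n) (x : Fin n → Fin m) (s : S) : ℝ :=
  ((2 : ℝ) ^ n)⁻¹ * ∑ d : Fin n → Bool,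
    (G (Function.update (pt x d) j (x j).succ) s - G (Function.update (pt x d) j (x j).castSucc) s)

lemma Vf_eq {n m : ℕ} {S : Type} (G : (Fin n → Fin (m + 1)) → S → ℝ) (j : Fin n) (x : Fin n → Fin m) (s : S)
    (c0 : ℝ) : Vf G j x s = ((2 : ℝ) ^ n)⁻¹ * ∑ d : Fin n → Bool, sg (d j) * (2 * (G (pt x d) s - c0)) := by
  rw [← diff_sum (fun d => G (pt x d) s) j c0]
  simp only [Vf, pt_true, pt_false]

lemma Vf_tele {n m : ℕ} {S : Type} (G : (Fin n → Fin (m + 1)) → S → ℝ) (j : Fin n) (x : Fin n → Fin m) (s : S) :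
    ∑ k, Vf G j (Function.update x j k) s = ((2 : ℝ) ^ n)⁻¹ * ∑ d : Fin n → Bool,
      (G (Function.update (pt x d) j (Fin.last m)) s - G (Function.update (pt x d) j 0) s) := by
  simp only [Vf, pt_upd, Function.update_self]
  rw [← Finset.mul_sum, Finset.sum_comm]
  congr 1
  refine Finset.sum_congr rfl fun d _ => ?_
  exact fin_tele m fun k => G (Function.update (pt x d) j k) s

lemma Vf_meas {n m : ℕ} {S : Type} [MeasurableSpace S] (G : (Fin n → Fin (m + 1)) → S → ℝ) (hG : ∀ a, Measurable (G a))
    (j : Fin n) (x : Fin n → Fin m) : Measurable (Vf G j x) :=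
  (Finset.measurable_fun_sum _ fun d _ => (hG _).sub (hG _)).const_mul _

lemma Good.smul {S : Type} [MeasurableSpace S] {ρ : (S → ℝ≥0∞) → ℝ≥0∞} {t w : ℝ} (hρ : Good ρ t w)
    {c : ℝ} (hc : 0 ≤ c) {X : S → ℝ} (hX : Measurable X) :
    ρ (fun s => ‖c * X s‖ₑ) = ENNReal.ofReal c * ρ (fun s => ‖X s‖ₑ) := by
  have := hρ.homog c.toNNReal (fun s => ‖X s‖ₑ) hX.enorm
  simp only [enorm_mul, Real.enorm_eq_ofReal hc]
  exact this

lemma Good.avg {S : Type} [MeasurableSpace S] {ρ : (S → ℝ≥0∞) → ℝ≥0∞} {t w : ℝ} (hρ : Good ρ t w)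
    (ht : 1 ≤ t) {n : ℕ} (D : (Fin n → Bool) → S → ℝ) (hD : ∀ d, Measurable (D d)) {B : ℝ≥0∞}
    (hB : ∀ d, ρ (fun s => ‖D d s‖ₑ) ≤ B) : ρ (fun s => ‖((2 : ℝ) ^ n)⁻¹ * ∑ d, D d s‖ₑ) ≤ B := by
  rw [hρ.smul (by positivity) (Finset.measurable_fun_sum _ fun d _ => hD d)]
  calc _ ≤ ENNReal.ofReal (((2 : ℝ) ^ n)⁻¹) * ∑ d : Fin n → Bool, B := by
        gcongr
        exact (hρ.tri ht Finset.univ D hD).trans (Finset.sum_le_sum fun d _ => hB d)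
    _ = B := by
        rw [ENNReal.ofReal_inv_of_pos (by positivity)]
        simp only [Finset.sum_const, Finset.card_univ, nsmul_eq_mul, Fintype.card_fun, Fintype.card_bool,
          Fintype.card_fin]
        rw [ENNReal.ofReal_pow (by norm_num), ← mul_assoc]
        push_cast
        rw [ENNReal.ofReal_ofNat, ENNReal.inv_mul_cancel (by simp) (by simp), one_mul]

/-- closeness in sup distance -/
def near {n m : ℕ} (y x : Fin n → Fin (m + 1)) : Prop := ∀ i, |((y i : ℕ) : ℝ) - ((x i : ℕ) : ℝ)| ≤ 1

lemma near_pt {n m : ℕ} (x : Fin n → Fin m) (d : Fin n → Bool) : near (pt x d) (fun i => (x i).castSucc) := by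
  intro i
  simp only [pt]
  split_ifs <;> simp

lemma near_upd {n m : ℕ} {y x : Fin n → Fin (m + 1)} (h : near y x) (j : Fin n) (b : Fin (m + 1)) :
    near (Function.update y j b) (Function.update x j b) := by
  intro i
  by_cases hi : i = j
  · subst hi; simp
  · simpa [Function.update_of_ne hi] using h i

lemma sum_upd {n m : ℕ} (j : Fin n) (F : (Fin n → Fin m) → ℝ≥0∞) :
    ∑ x : Fin n → Fin m, ∑ k, F (Function.update x j k) = m * ∑ x, F x := by
  let T : (Fin n → Fin m) × Fin m → (Fin n → Fin m) × Fin m := fun z => (Function.update z.1 j z.2, z.1 j)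
  have hT : Function.Involutive T := fun z => by simp [T]
  have h := Equiv.sum_comp hT.toPerm fun z => F z.1
  rw [Fintype.sum_prod_type, Fintype.sum_prod_type] at h
  calc _ = ∑ x : Fin n → Fin m, ∑ k : Fin m, F x := h
    _ = _ := by simp [Finset.mul_sum]

lemma stepA {S : Type} [MeasurableSpace S] {ρ : (S → ℝ≥0∞) → ℝ≥0∞} {u cc : ℝ} (hρ : Good ρ u cc)
    (hu : 1 ≤ u) {n m : ℕ} (G : (Fin n → Fin (m + 1)) → S → ℝ) (hG : ∀ a, Measurable (G a)) {B : ℝ≥0∞}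
    (hB : B ≠ ∞)
    (hup : ∀ y x, near y x → ρ (fun s => ‖G y s - G x s‖ₑ) ≤ B)
    (hlow : ∀ x j, 4 * B ≤ ρ (fun s => ‖G (Function.update x j (Fin.last m)) s - G (Function.update x j 0) s‖ₑ))
    (j : Fin n) (x : Fin n → Fin m) :
    2 * B ≤ ∑ k, ρ (fun s => ‖Vf G j (Function.update x j k) s‖ₑ) := by
  let x' : Fin n → Fin (m + 1) := fun i => (x i).castSucc
  let E : Fin (m + 1) → S → ℝ := fun b s => ((2 : ℝ) ^ n)⁻¹ * ∑ d : Fin n → Bool,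
    (G (Function.update (pt x d) j b) s - G (Function.update x' j b) s)
  have hEm : ∀ b, Measurable (E b) := fun b =>
    (Finset.measurable_fun_sum _ fun d _ => (hG _).sub (hG _)).const_mul _
  have hE : ∀ b, ρ (fun s => ‖E b s‖ₑ) ≤ B := fun b =>
    hρ.avg hu _ (fun d => (hG _).sub (hG _)) fun d => hup _ _ (near_upd (near_pt x d) j b)
  have e1 : ∀ s, G (Function.update x' j (Fin.last m)) s - G (Function.update x' j 0) s =
      ∑ k, Vf G j (Function.update x j k) s - (E (Fin.last m) s - E 0 s) := by
    intro s
    rw [Vf_tele]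
    simp only [E, Finset.sum_sub_distrib, mul_sub]
    simp
    ring
  have h1 := hlow x' j
  simp only [e1] at h1
  have h2 := h1.trans (hρ.tri2 hu (Finset.measurable_fun_sum _ fun k _ => Vf_meas G hG j _)
    ((hEm (Fin.last m)).sub (hEm 0)))
  have h3 := h2.trans (add_le_add (hρ.tri hu Finset.univ (fun k => Vf G j (Function.update x j k))
    (fun k => Vf_meas G hG j _)) ((hρ.tri2 hu (hEm (Fin.last m)) (hEm 0)).trans (add_le_add (hE _) (hE _))))
  have h4 : 2 * B + 2 * B ≤ ∑ k, ρ (fun s => ‖Vf G j (Function.update x j k) s‖ₑ) + 2 * B := by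
    rw [← add_mul]; norm_num
    rw [two_mul]; exact h3
  exact (ENNReal.add_le_add_iff_right (ENNReal.mul_ne_top (by norm_num) hB)).1 h4

lemma stepB {u cc : ℝ} (hu : 1 < u) (hcc : 2 ≤ cc) : ∃ K : ℝ≥0,
    ∀ {S : Type} [MeasurableSpace S] {ρ : (S → ℝ≥0∞) → ℝ≥0∞} (_ : Good ρ u cc)
    {n m : ℕ} (G : (Fin n → Fin (m + 1)) → S → ℝ) (_ : ∀ a, Measurable (G a)) {B : ℝ≥0∞}
    (_ : ∀ y x, near y x → ρ (fun s => ‖G y s - G x s‖ₑ) ≤ B) (x : Fin n → Fin m),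
    ∑ j, ρ (fun s => ‖Vf G j x s‖ₑ) ≤ (n : ℝ≥0∞) ^ (1 - 1 / cc) * (K * (2 * B)) := by
  have hc0 : 0 < cc := by linarith
  have hu0 : 0 < u := by linarith
  obtain ⟨K, hK⟩ := khin2 hu hcc
  refine ⟨K, ?_⟩
  intro S _ ρ hρ n m G hG B hup x
  let g : (Fin n → Bool) → S → ℝ := fun d s => 2 * (G (pt x d) s - G (fun i => (x i).castSucc) s)
  have hg : ∀ d, Measurable (g d) := fun d => ((hG _).sub (hG _)).const_mul _
  have hgB : ∀ d, ρ (fun s => ‖g d s‖ₑ) ≤ 2 * B := by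
    intro d
    have := hρ.smul (c := 2) (by norm_num) ((hG (pt x d)).sub (hG (fun i => (x i).castSucc)))
    simp only [Pi.sub_apply] at this
    simp only [g, this, ENNReal.ofReal_ofNat]
    gcongr
    exact hup _ _ (near_pt x d)
  let c : ℝ≥0 := (Real.toNNReal (((2 : ℝ) ^ n)⁻¹)) ^ (1 / u)
  have hc : (c : ℝ≥0∞) ^ u = ENNReal.ofReal (((2 : ℝ) ^ n)⁻¹) := by
    rw [← ENNReal.coe_rpow_of_nonneg _ hu0.le]
    simp only [c]
    rw [← NNReal.rpow_mul, one_div_mul_cancel hu0.ne', NNReal.rpow_one]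
    rfl
  have s1 : ∑ j, ρ (fun s => ‖Vf G j x s‖ₑ) ≤
      (n : ℝ≥0∞) ^ (1 - 1 / cc) * (∑ j, ρ (fun s => ‖Vf G j x s‖ₑ) ^ cc) ^ (1 / cc) := by
    have := ENNReal.rpow_sum_le_const_mul_sum_rpow Finset.univ (fun j => ρ (fun s => ‖Vf G j x s‖ₑ))
      (show 1 ≤ cc by linarith)
    have := ENNReal.rpow_le_rpow this (show 0 ≤ 1 / cc by positivity)
    rw [← ENNReal.rpow_mul, mul_one_div_cancel hc0.ne', ENNReal.rpow_one,
      ENNReal.mul_rpow_of_nonneg _ _ (by positivity), ← ENNReal.rpow_mul,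
      show (cc - 1) * (1 / cc) = 1 - 1 / cc by field_simp] at this
    simpa using this
  have s2 := hρ.conc (Fin n) Finset.univ (fun j s => ‖Vf G j x s‖ₑ) (fun j => (Vf_meas G hG j x).enorm)
  have hm : Measurable fun s => (∑ d, (c * ‖g d s‖ₑ) ^ u) ^ (1 / u) :=
    (Finset.measurable_fun_sum _ fun d _ => ((hg d).enorm.const_mul _).pow_const _).pow_const _
  have s3 : ρ (fun s => (∑ j, ‖Vf G j x s‖ₑ ^ cc) ^ (1 / cc)) ≤
      ρ (fun s => K * (∑ d, (c * ‖g d s‖ₑ) ^ u) ^ (1 / u)) := by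
    refine hρ.mono _ _ fun s => ?_
    have := hK n (fun d => g d s)
    simp only [ENNReal.mul_rpow_of_nonneg _ _ hu0.le, hc]
    refine le_trans (le_of_eq ?_) this
    congr 1
    refine Finset.sum_congr rfl fun j _ => ?_
    rw [Vf_eq G j x s (G (fun i => (x i).castSucc) s)]
  rw [hρ.homog K _ hm] at s3
  have s4 := hρ.conv u hu.le le_rfl (Fin n → Bool) Finset.univ (fun d s => c * ‖g d s‖ₑ)
    (fun d => (hg d).enorm.const_mul _)
  have s5 : (∑ d, ρ (fun s => c * ‖g d s‖ₑ) ^ u) ^ (1 / u) ≤ 2 * B := by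
    have : ∀ d, ρ (fun s => c * ‖g d s‖ₑ) = c * ρ (fun s => ‖g d s‖ₑ) := fun d => hρ.homog c _ (hg d).enorm
    simp only [this, ENNReal.mul_rpow_of_nonneg _ _ hu0.le, hc]
    calc _ ≤ (∑ d : Fin n → Bool, ENNReal.ofReal (((2 : ℝ) ^ n)⁻¹) * (2 * B) ^ u) ^ (1 / u) := by
          gcongr with d _
          exact hgB d
      _ = ((2 * B) ^ u) ^ (1 / u) := by
          congr 1
          rw [ENNReal.ofReal_inv_of_pos (by positivity)]
          simp only [Finset.sum_const, Finset.card_univ, nsmul_eq_mul, Fintype.card_fun, Fintype.card_bool,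
            Fintype.card_fin]
          rw [ENNReal.ofReal_pow (by norm_num), ← mul_assoc]
          push_cast
          rw [ENNReal.ofReal_ofNat, ENNReal.mul_inv_cancel (by simp) (by simp), one_mul]
      _ = _ := by rw [← ENNReal.rpow_mul, mul_one_div_cancel hu0.ne', ENNReal.rpow_one]
  refine s1.trans ?_
  gcongr
  exact s2.trans (s3.trans (mul_le_mul_right (s4.trans s5) _))

lemma box {u cc : ℝ} (hu : 1 < u) (hcc : 2 ≤ cc) : ∃ K : ℝ≥0,
    ∀ {S : Type} [MeasurableSpace S] {ρ : (S → ℝ≥0∞) → ℝ≥0∞} (_ : Good ρ u cc)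
    {n m : ℕ} (_ : 1 ≤ n) (_ : 1 ≤ m) (G : (Fin n → Fin (m + 1)) → S → ℝ) (_ : ∀ a, Measurable (G a)) {B : ℝ≥0∞}
    (_ : B ≠ 0) (_ : B ≠ ∞)
    (_ : ∀ y x, near y x → ρ (fun s => ‖G y s - G x s‖ₑ) ≤ B)
    (_ : ∀ x j, 4 * B ≤ ρ (fun s => ‖G (Function.update x j (Fin.last m)) s - G (Function.update x j 0) s‖ₑ)),
    (n : ℝ) ^ (1 / cc) ≤ K * m := by
  obtain ⟨K, hK⟩ := stepB hu hcc
  refine ⟨K, ?_⟩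
  intro S _ ρ hρ n m hn hm G hG B hB0 hB hup hlow
  have hn0 : (n : ℝ≥0∞) ≠ 0 := by simp; omega
  have hnR : (0 : ℝ) < n := by exact_mod_cast hn
  have h1 : ∑ j : Fin n, ∑ x : Fin n → Fin m, 2 * B ≤
      ∑ j : Fin n, ∑ x : Fin n → Fin m, ∑ k, ρ (fun s => ‖Vf G j (Function.update x j k) s‖ₑ) :=
    Finset.sum_le_sum fun j _ => Finset.sum_le_sum fun x _ => stepA hρ hu.le G hG hB hup hlow j x
  have h2 : ∑ j : Fin n, ∑ x : Fin n → Fin m, ∑ k, ρ (fun s => ‖Vf G j (Function.update x j k) s‖ₑ) =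
      m * ∑ x : Fin n → Fin m, ∑ j, ρ (fun s => ‖Vf G j x s‖ₑ) := by
    rw [Finset.sum_comm (s := (Finset.univ : Finset (Fin n → Fin m))), Finset.mul_sum]
    refine Finset.sum_congr rfl fun j _ => ?_
    exact sum_upd j fun x => ρ (fun s => ‖Vf G j x s‖ₑ)
  have h3 : ∑ x : Fin n → Fin m, ∑ j, ρ (fun s => ‖Vf G j x s‖ₑ) ≤
      ∑ x : Fin n → Fin m, (n : ℝ≥0∞) ^ (1 - 1 / cc) * (K * (2 * B)) :=
    Finset.sum_le_sum fun x _ => hK hρ G hG hup x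
  rw [h2] at h1
  have h4 := h1.trans (mul_le_mul_right h3 _)
  simp only [Finset.sum_const, nsmul_eq_mul, Finset.card_univ] at h4
  set N : ℝ≥0∞ := (Fintype.card (Fin n → Fin m) : ℝ≥0∞) with hN
  have hN0 : N ≠ 0 := by
    have : Nonempty (Fin n → Fin m) := ⟨fun _ => ⟨0, hm⟩⟩
    have : Fintype.card (Fin n → Fin m) ≠ 0 := Fintype.card_ne_zero
    rw [hN]; exact_mod_cast this
  have hNT : N ≠ ∞ := ENNReal.natCast_ne_top _
  simp only [Fintype.card_fin] at h4
  have h5 : (N * (2 * B)) * n ≤ (N * (2 * B)) * (n ^ (1 - 1 / cc) * (K * m)) := by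
    calc _ = n * (N * (2 * B)) := by ring
      _ ≤ _ := h4
      _ = _ := by ring
  rw [ENNReal.mul_le_mul_iff_right (by simp [hN0, hB0]) (by
    exact ENNReal.mul_ne_top hNT (ENNReal.mul_ne_top (by norm_num) hB))] at h5
  have e1 : (n : ℝ≥0∞) = ENNReal.ofReal n := by simp
  have e2 : (m : ℝ≥0∞) = ENNReal.ofReal m := by simp
  have e3 : (K : ℝ≥0∞) = ENNReal.ofReal K := by simp
  rw [e1, e2, e3, ENNReal.ofReal_rpow_of_pos hnR, ← ENNReal.ofReal_mul (by positivity),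
    ← ENNReal.ofReal_mul (by positivity), ENNReal.ofReal_le_ofReal_iff (by positivity),
    Real.rpow_sub hnR, Real.rpow_one, div_mul_eq_mul_div, le_div_iff₀ (by positivity)] at h5
  exact le_of_mul_le_mul_left h5 hnR

theorem T3 {r α u cc : ℝ} (hr : 1 ≤ r) (hα : 0 < α) (hu : 1 < u) (hcc : 2 ≤ cc) (H : Mdl r α u cc) : r ≤ cc := by
  have hr0 : 0 < r := by linarith
  have hc0 : 0 < cc := by linarith
  obtain ⟨C, hC, hM⟩ := H (fun k => Fin (k.unpair.1 + 1) → Fin (k.unpair.2 + 1)) (fun k => Fin (k.unpair.1 + 1))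
    (fun k x i => ((x i : ℕ) : ℝ)) (fun k x y h => by
      funext i
      have : ((x i : ℕ) : ℝ) = ((y i : ℕ) : ℝ) := congrFun h i
      exact Fin.ext (by exact_mod_cast this))
  have hM2 : ∀ k n' m : ℕ, k.unpair.1 = n' → k.unpair.2 = m →
      ∃ (S : Type) (_ : MeasurableSpace S) (ρ : (S → ℝ≥0∞) → ℝ≥0∞)
      (G : (Fin (n' + 1) → Fin (m + 1)) → S → ℝ), Good ρ u cc ∧ (∀ a, Measurable (G a)) ∧ ∀ a b,
        ρ (fun x => ‖G a x - G b x‖ₑ) ≤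
          ENNReal.ofReal (C * (∑ i, |((a i : ℕ) : ℝ) - ((b i : ℕ) : ℝ)| ^ r) ^ (α / r)) ∧
        ENNReal.ofReal ((∑ i, |((a i : ℕ) : ℝ) - ((b i : ℕ) : ℝ)| ^ r) ^ (α / r)) ≤
          ENNReal.ofReal C * ρ (fun x => ‖G a x - G b x‖ₑ) := by
    intro k n' m h1 h2
    subst h1
    subst h2
    exact hM k
  obtain ⟨K, hK⟩ := box hu hcc
  set D := (4 * C ^ 2) ^ (1 / α) with hD
  have hD0 : 0 < D := by positivity
  have key : 1 / cc ≤ 1 / r := by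
    refine growth (K := K * (D + 1)) fun n hn => ?_
    have hn1 : (1 : ℝ) ≤ n := by exact_mod_cast hn
    obtain ⟨n', rfl⟩ : ∃ n', n = n' + 1 := ⟨n - 1, by omega⟩
    set n := n' + 1 with hn'
    set m := ⌈D * (n : ℝ) ^ (1 / r)⌉₊ with hm
    have hnr : 1 ≤ (n : ℝ) ^ (1 / r) := Real.one_le_rpow hn1 (by positivity)
    have hm1 : 1 ≤ m := Nat.one_le_ceil_iff.2 (by positivity)
    have hmle : (m : ℝ) ≤ (D + 1) * (n : ℝ) ^ (1 / r) := by
      have := (Nat.ceil_lt_add_one (show 0 ≤ D * (n : ℝ) ^ (1 / r) by positivity)).le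
      rw [← hm] at this
      linarith
    have hmge : D * (n : ℝ) ^ (1 / r) ≤ m := Nat.le_ceil _
    obtain ⟨S, _, ρ, G, hρ, hG, hb⟩ := hM2 (Nat.pair n' m) n' m (by simp) (by simp)
    have := hK hρ (n := n) (m := m) hn hm1 G hG (B := ENNReal.ofReal (C * (n : ℝ) ^ (α / r)))
      (by simp; positivity) ENNReal.ofReal_ne_top (fun y x hyx => ?_) (fun x j => ?_)
    · calc _ ≤ _ := this
        _ ≤ K * ((D + 1) * (n : ℝ) ^ (1 / r)) := by gcongr
        _ = _ := by ring
    · refine (hb y x).1.trans (ENNReal.ofReal_le_ofReal ?_)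
      gcongr
      calc _ ≤ ∑ i : Fin n, (1 : ℝ) := by
            refine Finset.sum_le_sum fun i _ => ?_
            exact Real.rpow_le_one (abs_nonneg _) (hyx i) hr0.le
        _ = _ := by simp
    · have h1 := (hb (Function.update x j (Fin.last m)) (Function.update x j 0)).2
      have h2 : ∑ i : Fin n, |(((Function.update x j (Fin.last m) : Fin n → Fin (m + 1)) i : ℕ) : ℝ) -
          (((Function.update x j 0 : Fin n → Fin (m + 1)) i : ℕ) : ℝ)| ^ r = (m : ℝ) ^ r := by
        rw [Finset.sum_eq_single j]
        · simp
        · intro i _ hi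
          simp [Function.update_of_ne hi, hr0.ne']
        · simp
      rw [h2, ← Real.rpow_mul (by positivity), mul_div_cancel₀ _ hr0.ne'] at h1
      have h3 : 4 * C ^ 2 * (n : ℝ) ^ (α / r) ≤ (m : ℝ) ^ α := by
        calc _ = (D * (n : ℝ) ^ (1 / r)) ^ α := by
              rw [Real.mul_rpow hD0.le (by positivity), hD, ← Real.rpow_mul (by positivity),
                ← Real.rpow_mul (by positivity), one_div_mul_cancel hα.ne', Real.rpow_one]
              congr 2; ring
          _ ≤ _ := by gcongr
      have h4 : ENNReal.ofReal C * (4 * ENNReal.ofReal (C * (n : ℝ) ^ (α / r))) ≤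
          ENNReal.ofReal C * ρ (fun s => ‖G (Function.update x j (Fin.last m)) s - G (Function.update x j 0) s‖ₑ) := by
        refine le_trans ?_ h1
        rw [← ENNReal.ofReal_ofNat 4, ← ENNReal.ofReal_mul (by norm_num), ← ENNReal.ofReal_mul hC.le]
        refine ENNReal.ofReal_le_ofReal (le_trans (le_of_eq ?_) h3)
        ring
      exact (ENNReal.mul_le_mul_iff_right (by simpa using hC) ENNReal.ofReal_ne_top).1 h4
  exact (one_div_le_one_div hc0 hr0).1 key

end EBR


namespace EBR

lemma assemble {X Y : Type*} [NormedAddCommGroup X] [NormedSpace ℝ X] [MeasurableSpace X]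
    [NormedAddCommGroup Y] [NormedSpace ℝ Y] [SecondCountableTopology Y]
    [MeasurableSpace Y] [BorelSpace Y] {p q r s : ℝ} (hp : 1 ≤ p) (hq : 1 ≤ q) (hr : 1 ≤ r) (hs : 1 ≤ s)
    (hred : BorelReducible (ESum X p) (ESum Y q))
    (hJ : ∀ (ι : Type) [Fintype ι] [Nonempty ι], ∃ J : (ι → ℝ) → X, ∀ a b,
      ‖J a - J b‖ ^ r = ∑ i, |a i - b i| ^ r)
    {Ω : Type} [MeasurableSpace Ω] (μ : Measure Ω) [SFinite μ] (g : Y → Ω → ℝ)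
    (hgm : ∀ y, Measurable (g y))
    (hg : ∀ y y', ∫⁻ ω, ‖g y ω - g y' ω‖ₑ ^ s ∂μ = ENNReal.ofReal (‖y - y'‖ ^ s)) :
    p ≤ q ∧ min (s/q) (min 1 (2/q)) ≤ min (r/p) (2/p) ∧ max r 2 ≤ max s (max q 2) := by
  obtain ⟨θ, hθ, hE⟩ := hred
  have hp0 : 0 < p := by linarith
  have hq0 : 0 < q := by linarith
  have hr0 : 0 < r := by linarith
  have hs0 : 0 < s := by linarith
  have hα : 0 < p / q := by positivity
  refine ⟨?_, ?_, ?_⟩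
  · have := T1 hr0 le_rfl (build1 hp0 hq0 hr0 hs0 hθ hE hJ μ g hgm hg (t := 1) (w := max s q) hs hq
      (le_max_left _ _) (le_max_right _ _))
    rwa [div_le_one hq0] at this
  · set t := min s (min q 2) with ht
    have hts : t ≤ s := min_le_left _ _
    have htq : t ≤ q := (min_le_right _ _).trans (min_le_left _ _)
    have ht2 : t ≤ 2 := (min_le_right _ _).trans (min_le_right _ _)
    have ht1 : 1 ≤ t := le_min hs (le_min hq (by norm_num))
    have hM := build1 hp0 hq0 hr0 hs0 hθ hE hJ μ g hgm hg (t := t) (w := max s (max q 2)) hts htq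
      (le_max_left _ _) ((le_max_left _ _).trans (le_max_right _ _))
    have hw : 2 ≤ max s (max q 2) := (le_max_right _ _).trans (le_max_right _ _)
    have h1 : t * (p / q) ≤ r := T2a hr hα ht1 ht2 hw hM
    have h2 : t * (p / q) ≤ 2 := by
      rcases le_total r 2 with h | h
      · linarith
      · exact T2b h hα ht1 ht2 hw hM
    have e : min (s/q) (min 1 (2/q)) ≤ t / q := by
      rw [le_div_iff₀ hq0, ht]
      refine le_min ?_ (le_min ?_ ?_)
      · rw [← le_div_iff₀ hq0]; exact min_le_left _ _
      · rw [← le_div_iff₀ hq0, div_self hq0.ne']; exact (min_le_right _ _).trans (min_le_left _ _)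
      · rw [← le_div_iff₀ hq0]; exact (min_le_right _ _).trans (min_le_right _ _)
    refine e.trans (le_min ?_ ?_)
    · rw [le_div_iff₀ hp0]
      calc t / q * p = t * (p / q) := by ring
        _ ≤ r := h1
    · rw [le_div_iff₀ hp0]
      calc t / q * p = t * (p / q) := by ring
        _ ≤ 2 := h2
  · refine max_le ?_ ((le_max_right _ _).trans (le_max_right _ _))
    by_contra hcon
    push Not at hcon
    set M := max s (max q 2) with hM
    have hM2 : 2 ≤ M := (le_max_right _ _).trans (le_max_right _ _)
    have hMs : s ≤ M := le_max_left _ _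
    have hMq : q ≤ M := (le_max_left _ _).trans (le_max_right _ _)
    obtain ⟨cc, hc1, hc2⟩ := exists_between hcon
    have hM0 : 0 < M := by linarith
    have hu : 1 < cc / M := (one_lt_div hM0).2 hc1
    have hu0 : 0 < cc / M := by linarith
    have e : cc / M * M = cc := div_mul_cancel₀ _ hM0.ne'
    have h := T3 hr (show 0 < p / (cc / M * q) by positivity) hu (show 2 ≤ cc by linarith)
      (build2 hp0 hq hr0 hs hθ hE hJ μ g hgm hg hu0
        (le_trans (mul_le_mul_of_nonneg_left hMs hu0.le) e.le)
        (le_trans (mul_le_mul_of_nonneg_left hMq hu0.le) e.le))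
    linarith

end EBR

theorem necessary_conditions_of_reducible (r s p q : ℝ) (hr : 1 ≤ r) (hs : 1 ≤ s)
    (hp : 1 ≤ p) (hq : 1 ≤ q)
    [Fact (1 ≤ ENNReal.ofReal r)] [Fact (1 ≤ ENNReal.ofReal s)]
    (hred : BorelReducible (ESum (ellSp r) p) (ESum (ellSp s) q) ∨
      BorelReducible (ESum (LSp r) p) (ESum (LSp s) q)) :
    p ≤ q ∧ min (s/q) (min 1 (2/q)) ≤ min (r/p) (2/p) ∧ max r 2 ≤ max s (max q 2) := by
  rcases hred with hred | hred
  · exact EBR.assemble hp hq hr hs hred (fun ι _ _ => EBR.ellSp_J r hr ι) (Measure.count : Measure ℕ)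
      (fun y n => y n) (fun y => measurable_from_nat) (EBR.ellSp_rep s hs)
  · have : Fact (ENNReal.ofReal s ≠ ∞) := ⟨ENNReal.ofReal_ne_top⟩
    exact EBR.assemble hp hq hr hs hred (fun ι _ _ => EBR.LSp_J r hr ι)
      ((volume : Measure ℝ).restrict (Set.Icc 0 1))
      (fun y x => y x) (fun y => (Lp.stronglyMeasurable y).measurable) (EBR.LSp_rep s hs)
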